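/- arXiv:1003.5639 — 2 statements merged into one kernel-verified Lean document; each statement's English description precedes it below -/
import Mathlib

section
/- A valued field (K,v) of characteristic p>0 is inseparably defectless if and only if for every n ≥ 1 and all elements b, b₁, …, bₙ ∈ K such that b₁, …, bₙ form a basis of a finite extension of K^p inside K (that is, b₁, …, bₙ are a K^p-basis of the subfield K^p(b₁,…,bₙ) of K), the field (K,v) is K-extremal with respect to the polynomial b − ∑_{i=1}^n bᵢ Xᵢ^p in the n variables X₁,…,Xₙ. -/
open scoped Classical

noncomputable section

namespace ValuedDefect

universe u v

variable {K : Type u} {L : Type v} [Field K] [Field L]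

/-- The ramification index `(vL : vK)`: the index of the image of `Kˣ` in the
value group `Lˣ / Bˣ` of the valuation subring `B` of `L`. -/
def ramIndex (K : Type u) {L : Type v} [Field K] [Field L] [Algebra K L]
    (B : ValuationSubring L) : ℕ :=
  (Subgroup.map (QuotientGroup.mk' B.unitGroup)
    (MonoidHom.range (Units.map (algebraMap K L).toMonoidHom))).index

/-- The ring homomorphism `A →+* B` induced by `algebraMap K L` when `B` lies above `A`. -/
def valHom [Algebra K L] (A : ValuationSubring K) (B : ValuationSubring L)
    (h : B.comap (algebraMap K L) = A) : A →+* B where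
  toFun x := ⟨algebraMap K L x, by
    have hx : (x : K) ∈ B.comap (algebraMap K L) := by rw [h]; exact x.2
    exact ValuationSubring.mem_comap.mp hx⟩
  map_one' := Subtype.ext (by simp)
  map_mul' x y := Subtype.ext (by simp)
  map_zero' := Subtype.ext (by simp)
  map_add' x y := Subtype.ext (by simp)

theorem valHom_isLocalHom [Algebra K L] (A : ValuationSubring K) (B : ValuationSubring L)
    (h : B.comap (algebraMap K L) = A) : IsLocalHom (valHom A B h) := by
  constructor
  intro x hx
  rcases isUnit_iff_exists_inv.mp hx with ⟨y, hy⟩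
  have hy' : algebraMap K L (x : K) * (y : L) = 1 := congrArg Subtype.val hy
  have hx0 : (x : K) ≠ 0 := by
    rintro h0
    rw [h0, map_zero, zero_mul] at hy'
    exact zero_ne_one hy'
  have hyx : (y : L) = algebraMap K L ((x : K)⁻¹) := by
    rw [map_inv₀]
    exact eq_inv_of_mul_eq_one_right hy'
  have hmem : ((x : K)⁻¹ : K) ∈ A := by
    have hB : algebraMap K L ((x : K)⁻¹) ∈ B := hyx ▸ y.2
    have := ValuationSubring.mem_comap.mpr hB
    rwa [h] at this
  refine isUnit_iff_exists_inv.mpr ⟨⟨(x : K)⁻¹, hmem⟩, Subtype.ext ?_⟩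
  exact mul_inv_cancel₀ hx0

/-- The residue degree `[Lv : Kv]` of an extension of valuation subrings. -/
def residueDegree [Algebra K L] (A : ValuationSubring K) (B : ValuationSubring L) : ℕ :=
  if h : B.comap (algebraMap K L) = A then
    letI := valHom_isLocalHom A B h
    letI := (IsLocalRing.ResidueField.map (valHom A B h)).toAlgebra
    Module.finrank (IsLocalRing.ResidueField A) (IsLocalRing.ResidueField B)
  else 0

/-- A finite extension of valued fields (with unique extension of the valuation) is
defectless if `[L : K] = (vL : vK) · [Lv : Kv]`. -/
def IsDefectless [Algebra K L] (A : ValuationSubring K) (B : ValuationSubring L) : Prop :=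
  Module.finrank K L = ramIndex K B * residueDegree A B

/-- An extension of valued fields is immediate if `vL = vK` and `Lv = Kv`. -/
def IsImmediate (K : Type u) {L : Type v} [Field K] [Field L] [Algebra K L]
    (B : ValuationSubring L) : Prop :=
  (∀ x : L, x ≠ 0 → ∃ c : K, B.valuation x = B.valuation (algebraMap K L c)) ∧
  ∀ x : L, B.valuation x ≤ 1 → ∃ c : K, B.valuation (x - algebraMap K L c) < 1

/-- A valued field is a defectless field if every finite extension is defectless. -/
def IsDefectlessField {K : Type u} [Field K] (A : ValuationSubring K) : Prop :=
  ∀ (L : Type u) [Field L] [Algebra K L], FiniteDimensional K L →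
    ∀ B : ValuationSubring L, B.comap (algebraMap K L) = A → IsDefectless A B

/-- A valued field is a separably defectless field if every finite separable extension is
defectless. -/
def IsSepDefectlessField {K : Type u} [Field K] (A : ValuationSubring K) : Prop :=
  ∀ (L : Type u) [Field L] [Algebra K L], FiniteDimensional K L → Algebra.IsSeparable K L →
    ∀ B : ValuationSubring L, B.comap (algebraMap K L) = A → IsDefectless A B

/-- A valued field is inseparably defectless if every finite purely inseparable extension is
defectless. -/
def IsInsepDefectless {K : Type u} [Field K] (A : ValuationSubring K) : Prop :=
  ∀ (L : Type u) [Field L] [Algebra K L], FiniteDimensional K L → IsPurelyInseparable K L →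
    ∀ B : ValuationSubring L, B.comap (algebraMap K L) = A → IsDefectless A B

/-- A valued field is algebraically maximal if it admits no proper immediate algebraic
extension. -/
def IsAlgMaximal {K : Type u} [Field K] (A : ValuationSubring K) : Prop :=
  ∀ (L : Type u) [Field L] [Algebra K L], Algebra.IsAlgebraic K L →
    ∀ B : ValuationSubring L, B.comap (algebraMap K L) = A → IsImmediate K B →
      Function.Surjective (algebraMap K L)

/-- A valued field is separable-algebraically maximal if it admits no proper immediate
separable-algebraic extension. -/
def IsSepAlgMaximal {K : Type u} [Field K] (A : ValuationSubring K) : Prop :=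
  ∀ (L : Type u) [Field L] [Algebra K L], Algebra.IsAlgebraic K L → Algebra.IsSeparable K L →
    ∀ B : ValuationSubring L, B.comap (algebraMap K L) = A → IsImmediate K B →
      Function.Surjective (algebraMap K L)

/-- `(K,v)` is `K`-extremal with respect to `f` if the set `{v f(a) : a ∈ K}` has a maximum
(in the multiplicative convention: a minimum). -/
def KExtremal (A : ValuationSubring K) (f : Polynomial K) : Prop :=
  ∃ a : K, ∀ b : K, A.valuation (f.eval a) ≤ A.valuation (f.eval b)

/-- `(K,v)` is `O`-extremal with respect to `f` if the set `{v f(a) : a ∈ O}` has a maximum. -/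
def OExtremal (A : ValuationSubring K) (f : Polynomial K) : Prop :=
  ∃ a : A, ∀ b : A, A.valuation (f.eval (a : K)) ≤ A.valuation (f.eval (b : K))

/-- `K`-extremality for multivariable polynomials. -/
def KExtremalMv (A : ValuationSubring K) {n : ℕ} (f : MvPolynomial (Fin n) K) : Prop :=
  ∃ a : Fin n → K, ∀ b : Fin n → K,
    A.valuation (MvPolynomial.eval a f) ≤ A.valuation (MvPolynomial.eval b f)

/-- A `p`-polynomial: an additive polynomial plus a constant. -/
def IsPPolynomial (p : ℕ) (f : Polynomial K) : Prop :=
  ∃ (c : K) (m : ℕ) (co : ℕ → K),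
    f = Polynomial.C c + ∑ i ∈ Finset.range (m + 1), Polynomial.C (co i) * Polynomial.X ^ p ^ i

/-- A field of characteristic `p > 0` is Artin-Schreier closed if every polynomial
`X^p - X - a` has a root. -/
def ASClosed (K : Type*) [Field K] (p : ℕ) : Prop :=
  ∀ a : K, ∃ x : K, x ^ p - x = a

/-- The subfield `K^p` of `p`-th powers of a field of characteristic `p`. -/
def pPowerSubfield (K : Type*) [Field K] (p : ℕ) (hp : p.Prime) [CharP K p] : Subfield K :=
  haveI : Fact p.Prime := ⟨hp⟩
  (frobenius K p).fieldRange

/-- The field `K^{1/p}` of `p`-th roots of `K` inside a purely inseparable extension `P`. -/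
def pthRootField (K : Type u) (P : Type v) [Field K] [Field P] [Algebra K P]
    (p : ℕ) (hp : p.Prime) [CharP K p] : IntermediateField K P :=
  haveI : Fact p.Prime := ⟨hp⟩
  haveI : CharP P p := charP_of_injective_algebraMap (algebraMap K P).injective p
  { carrier := {x : P | x ^ p ∈ (algebraMap K P).range}
    mul_mem' := fun {a b} ha hb => by
      rcases ha with ⟨c, hc⟩
      rcases hb with ⟨d, hd⟩
      exact ⟨c * d, by rw [map_mul, hc, hd, mul_pow]⟩
    one_mem' := ⟨1, by rw [map_one, one_pow]⟩
    add_mem' := fun {a b} ha hb => by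
      rcases ha with ⟨c, hc⟩
      rcases hb with ⟨d, hd⟩
      exact ⟨c + d, by rw [map_add, hc, hd, add_pow_char]⟩
    zero_mem' := ⟨0, by rw [map_zero, zero_pow hp.ne_zero]⟩
    algebraMap_mem' := fun r => ⟨r ^ p, by rw [map_pow]⟩
    inv_mem' := fun x hx => by
      rcases hx with ⟨c, hc⟩
      exact ⟨c⁻¹, by rw [map_inv₀, hc, inv_pow]⟩ }

/-- A (possibly infinite) algebraic extension of valued fields is defectless if every finite
subextension is defectless. -/
def IsDefectlessAlgExt {K : Type u} {L : Type v} [Field K] [Field L] [Algebra K L]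
    (A : ValuationSubring K) (B : ValuationSubring L) : Prop :=
  ∀ E : IntermediateField K L, FiniteDimensional K E →
    IsDefectless A (B.comap (algebraMap E L))


/-- A finite family `z` in a valued field `(M, w)` is orthogonal over a subfield `k` if its members
are nonzero and the value of a `k`-linear combination is the largest value of its terms. -/
structure IsOrthogonal {M : Type*} [Field M] {Γ : Type*} [LinearOrderedCommGroupWithZero Γ]
    (k : Subfield M) (w : Valuation M Γ) {ι : Type*} [Fintype ι] (z : ι → M) : Prop where
  ne_zero : ∀ i, z i ≠ 0
  le : ∀ (a : ι → k) (i : ι), w (a i * z i) ≤ w (∑ j, (a j : M) * z j)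

section Orthogonal

variable {M : Type*} [Field M] {Γ : Type*} [LinearOrderedCommGroupWithZero Γ]
  {k : Subfield M} {w : Valuation M Γ} {ι : Type*} [Fintype ι] {z : ι → M}

theorem mem_span_range_iff_exists_coeff {x : M} :
    x ∈ Submodule.span k (Set.range z) ↔ ∃ a : ι → k, ∑ i, (a i : M) * z i = x :=
  Submodule.mem_span_range_iff_exists_fun k

theorem IsOrthogonal.linearIndependent (h : IsOrthogonal k w z) : LinearIndependent k z := by
  rw [Fintype.linearIndependent_iff]
  intro a ha i
  have h1 := h.le a i
  have h2 : ∑ j, (a j : M) * z j = 0 := ha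
  rw [h2, map_zero, le_zero_iff, map_eq_zero, mul_eq_zero] at h1
  exact Subtype.ext (h1.resolve_right (h.ne_zero i))

/-- Exchange: a member of an orthogonal family may be replaced by a linear combination in which
its term is dominant. -/
theorem IsOrthogonal.update (h : IsOrthogonal k w z) (c : ι → k) (i : ι) (hci : c i ≠ 0)
    (hc : ∀ j, w (c j * z j) ≤ w (c i * z i)) :
    IsOrthogonal k w (Function.update z i (∑ j, (c j : M) * z j)) := by
  have hci' : (c i : M) ≠ 0 := fun h0 => hci (Subtype.ext h0)
  constructor
  · intro j
    by_cases hj : j = i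
    · subst hj
      rw [Function.update_self]
      intro h0
      have := h.le c j
      rw [h0, map_zero, le_zero_iff, map_eq_zero, mul_eq_zero] at this
      exact this.elim hci' (h.ne_zero j)
    · rw [Function.update_of_ne hj]
      exact h.ne_zero j
  · intro a
    have key : ∑ j, (a j : M) * Function.update z i (∑ j, (c j : M) * z j) j =
        ∑ j, (((if j = i then 0 else a j) + a i * c j : k) : M) * z j := by
      rw [← Finset.add_sum_erase _ _ (Finset.mem_univ i), Function.update_self, Finset.mul_sum]
      have h1 : ∑ j ∈ Finset.univ.erase i,
          (a j : M) * Function.update z i (∑ j, (c j : M) * z j) j =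
          ∑ j, ((if j = i then 0 else a j : k) : M) * z j := by
        rw [← Finset.add_sum_erase _ (fun j => ((if j = i then 0 else a j : k) : M) * z j)
          (Finset.mem_univ i)]
        simp only [if_true, ZeroMemClass.coe_zero, zero_mul, zero_add]
        refine Finset.sum_congr rfl fun j hj => ?_
        rw [Function.update_of_ne (Finset.ne_of_mem_erase hj), if_neg (Finset.ne_of_mem_erase hj)]
      rw [h1, ← Finset.sum_add_distrib]
      refine Finset.sum_congr rfl fun j _ => ?_
      push_cast
      ring
    rw [key]
    set d : ι → k := fun j => (if j = i then 0 else a j) + a i * c j with hd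
    have hle := h.le d
    have hi : w (a i * (c i * z i)) ≤ w (∑ j, (d j : M) * z j) := by
      have e : (d i : M) * z i = a i * (c i * z i) := by simp [hd, mul_assoc]
      exact e ▸ hle i
    have hac : ∀ j, w (a i * (c j * z j)) ≤ w (∑ j, (d j : M) * z j) := fun j => by
      refine le_trans ?_ hi
      rw [map_mul, map_mul w _ (_ * z i)]
      exact mul_le_mul_right (hc j) _
    intro j
    by_cases hj : j = i
    · subst hj
      rw [Function.update_self, Finset.mul_sum]
      exact w.map_sum_le fun l _ => hac l
    · rw [Function.update_of_ne hj]
      have e : (a j : M) * z j = d j * z j - a i * (c j * z j) := by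
        simp only [hd, if_neg hj]
        push_cast
        ring
      rw [e]
      exact (w.map_sub _ _).trans (max_le (hle j) (hac j))

/-- Inside the span of an orthogonal family, every finitely generated subspace is spanned by part
of some orthogonal basis. -/
theorem IsOrthogonal.exists_adapted (h : IsOrthogonal k w z) (T : Finset M)
    (hT : (T : Set M) ⊆ Submodule.span k (Set.range z)) :
    ∃ (z' : ι → M) (J : Finset ι), IsOrthogonal k w z' ∧
      Submodule.span k (Set.range z') = Submodule.span k (Set.range z) ∧
      Submodule.span k (z' '' J) = Submodule.span k (T : Set M) := by
  induction T using Finset.induction_on with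
  | empty => exact ⟨z, ∅, h, rfl, by simp⟩
  | insert t T _ ih =>
    rw [Finset.coe_insert, Set.insert_subset_iff] at hT
    obtain ⟨z', J, hz', hspan, hJ⟩ := ih hT.2
    have ht := hT.1
    rw [SetLike.mem_coe, ← hspan, mem_span_range_iff_exists_coeff] at ht
    obtain ⟨a, ha⟩ := ht
    have hmem : ∀ j ∈ J, z' j ∈ Submodule.span k (T : Set M) := fun j hj => by
      rw [← hJ]
      exact Submodule.subset_span ⟨j, hj, rfl⟩
    set c : ι → k := fun j => if j ∈ J then 0 else a j with hc
    set t' : M := ∑ j, (c j : M) * z' j with ht'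
    have hdiff : t - t' ∈ Submodule.span k (T : Set M) := by
      rw [← ha, ht', ← Finset.sum_sub_distrib]
      refine Submodule.sum_mem _ fun j _ => ?_
      by_cases hj : j ∈ J
      · simpa [hc, hj, Subfield.smul_def] using Submodule.smul_mem _ (a j) (hmem j hj)
      · simp [hc, hj]
    have hins : Submodule.span k (insert t (T : Set M)) = Submodule.span k (insert t' (T : Set M)) := by
      rw [Submodule.span_insert, Submodule.span_insert]
      apply le_antisymm
      · refine sup_le ?_ le_sup_right
        rw [Submodule.span_singleton_le_iff_mem]
        have := Submodule.add_mem_sup (Submodule.mem_span_singleton_self (R := k) t') hdiff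
        rwa [add_sub_cancel] at this
      · refine sup_le ?_ le_sup_right
        rw [Submodule.span_singleton_le_iff_mem]
        have := Submodule.add_mem_sup (Submodule.mem_span_singleton_self (R := k) t)
          (Submodule.neg_mem _ hdiff)
        rwa [neg_sub, add_sub_cancel] at this
    rw [Finset.coe_insert, hins]
    by_cases h0 : ∀ j, c j = 0
    · have : t' = 0 := by simp [ht', h0]
      exact ⟨z', J, hz', hspan, by rw [this, Submodule.span_insert_zero, hJ]⟩
    · push Not at h0
      obtain ⟨j₀, hj₀⟩ := h0
      obtain ⟨i, -, hi⟩ := Finset.exists_max_image Finset.univ (fun j => w (c j * z' j))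
        ⟨j₀, Finset.mem_univ _⟩
      have hci : c i ≠ 0 := by
        intro h0
        have := hi j₀ (Finset.mem_univ _)
        simp only [h0, ZeroMemClass.coe_zero, zero_mul, map_zero, le_zero_iff, map_eq_zero,
          mul_eq_zero, ZeroMemClass.coe_eq_zero] at this
        exact this.elim hj₀ (hz'.ne_zero j₀)
      have hiJ : i ∉ J := fun hmem => hci (by simp [hc, hmem])
      have ho := hz'.update c i hci fun j => hi j (Finset.mem_univ _)
      refine ⟨Function.update z' i t', insert i J, ho, ?_, ?_⟩
      · have hle : Submodule.span k (Set.range (Function.update z' i t')) ≤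
            Submodule.span k (Set.range z') := by
          rw [Submodule.span_le]
          rintro _ ⟨j, rfl⟩
          by_cases hj : j = i
          · subst hj
            rw [Function.update_self]
            exact mem_span_range_iff_exists_coeff.2 ⟨c, rfl⟩
          · rw [Function.update_of_ne hj]
            exact Submodule.subset_span ⟨j, rfl⟩
        rw [← hspan]
        have : FiniteDimensional k (Submodule.span k (Set.range z')) :=
          FiniteDimensional.span_of_finite k (Set.finite_range z')
        refine Submodule.eq_of_le_of_finrank_eq hle ?_
        rw [finrank_span_eq_card ho.linearIndependent, finrank_span_eq_card hz'.linearIndependent]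
      · rw [Finset.coe_insert, Set.image_insert_eq, Function.update_self, Submodule.span_insert,
          Submodule.span_insert, ← hJ]
        congr 2
        refine Set.image_congr fun j hj => Function.update_of_ne ?_ _ _
        rintro rfl
        exact hiJ hj

/-- Elements of the span of an orthogonal family have best approximations in finitely generated
subspaces. -/
theorem IsOrthogonal.exists_best_approx (h : IsOrthogonal k w z) (T : Finset M)
    (hT : (T : Set M) ⊆ Submodule.span k (Set.range z)) {b : M}
    (hb : b ∈ Submodule.span k (Set.range z)) :
    ∃ y ∈ Submodule.span k (T : Set M), ∀ x ∈ Submodule.span k (T : Set M), w (b - y) ≤ w (b - x) := by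
  obtain ⟨z', J, hz', hspan, hJ⟩ := h.exists_adapted T hT
  rw [← hspan, mem_span_range_iff_exists_coeff] at hb
  obtain ⟨a, rfl⟩ := hb
  rw [← hJ]
  refine ⟨∑ j ∈ J, (a j : M) * z' j, Submodule.sum_mem _ fun j hj =>
    Submodule.smul_mem _ (a j) (Submodule.subset_span ⟨j, hj, rfl⟩), fun x hx => ?_⟩
  obtain ⟨d, hd, rfl⟩ : ∃ d : ι → k, (∀ j, j ∉ J → d j = 0) ∧ ∑ j, (d j : M) * z' j = x := by
    induction hx using Submodule.span_induction with
    | mem x hx =>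
      obtain ⟨i, hi, rfl⟩ := hx
      refine ⟨Pi.single i 1, fun j hj => Pi.single_eq_of_ne ?_ _, ?_⟩
      · rintro rfl
        exact hj hi
      · rw [Finset.sum_eq_single i]
        · simp
        · intro j _ hj
          simp [Pi.single_eq_of_ne hj]
        · simp
    | zero => exact ⟨0, by simp, by simp⟩
    | add x y _ _ hx hy =>
      obtain ⟨d, hd, rfl⟩ := hx
      obtain ⟨e, he, rfl⟩ := hy
      exact ⟨d + e, fun j hj => by simp [hd j hj, he j hj],
        by simp [add_mul, Finset.sum_add_distrib]⟩
    | smul r x _ hx =>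
      obtain ⟨d, hd, rfl⟩ := hx
      refine ⟨r • d, fun j hj => by simp [hd j hj], ?_⟩
      rw [Subfield.smul_def, smul_eq_mul, Finset.mul_sum]
      simp [mul_assoc]
  have e1 : ∑ j, (a j : M) * z' j - ∑ j ∈ J, (a j : M) * z' j = ∑ j ∈ Jᶜ, (a j : M) * z' j := by
    rw [sub_eq_iff_eq_add, Finset.sum_compl_add_sum]
  rw [e1]
  refine w.map_sum_le fun j hj => ?_
  have := hz'.le (a - d) j
  simpa only [Pi.sub_apply, hd j (Finset.mem_compl.1 hj), sub_zero, AddSubgroupClass.coe_sub,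
    sub_mul, Finset.sum_sub_distrib] using this

theorem IsOrthogonal.mul {κ : Type*} [Fintype κ] {k₁ : Subfield M} {y : κ → M}
    (h : IsOrthogonal k w y) (hy : ∀ i, y i ∈ k₁) (hk : k ≤ k₁) (h₁ : IsOrthogonal k₁ w z) :
    IsOrthogonal k w (fun q : κ × ι => y q.1 * z q.2) := by
  refine ⟨fun q => mul_ne_zero (h.ne_zero _) (h₁.ne_zero _), fun a q => ?_⟩
  have e : ∑ q : κ × ι, (a q : M) * (y q.1 * z q.2) =
      ∑ j, (∑ i, (a (i, j) : M) * y i) * z j := by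
    rw [Fintype.sum_prod_type_right]
    refine Finset.sum_congr rfl fun j _ => ?_
    rw [Finset.sum_mul]
    exact Finset.sum_congr rfl fun i _ => by ring
  rw [e, ← mul_assoc, map_mul w _ (z q.2)]
  refine le_trans ?_ (h₁.le (fun j => ⟨∑ i, (a (i, j) : M) * y i,
    sum_mem fun i _ => mul_mem (hk (a (i, j)).2) (hy i)⟩) q.2)
  rw [map_mul w _ (z q.2)]
  exact mul_le_mul_left (h.le (fun i => a (i, q.2)) q.1) _

theorem isOrthogonal_map_iff {N : Type*} [Field N] {Δ : Type*} [LinearOrderedCommGroupWithZero Δ]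
    {u : Valuation N Δ} (φ : M →+* N) (hφ : ∀ x y, u (φ x) ≤ u (φ y) ↔ w x ≤ w y) :
    IsOrthogonal (k.map φ) u (fun i => φ (z i)) ↔ IsOrthogonal k w z := by
  constructor
  · intro h
    refine ⟨fun i h0 => h.ne_zero i (by rw [h0, map_zero]), fun a i => ?_⟩
    rw [← hφ]
    simpa using h.le (fun i => ⟨φ (a i), Subfield.mem_map.2 ⟨a i, (a i).2, rfl⟩⟩) i
  · intro h
    refine ⟨fun i => by simpa using h.ne_zero i, fun a i => ?_⟩
    choose c hc hca using fun i => Subfield.mem_map.1 (a i).2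
    have := h.le (fun i => ⟨c i, hc i⟩) i
    rw [← hφ] at this
    simpa [hca] using this

/-- A sum of terms with pairwise distinct nonzero values dominates each of its terms. -/
theorem valuation_le_sum_of_injOn {κ : Type*} (s : Finset κ) (t : κ → M)
    (ht : ∀ i ∈ s, ∀ j ∈ s, i ≠ j → t i ≠ 0 → w (t i) ≠ w (t j)) {i : κ} (hi : i ∈ s) :
    w (t i) ≤ w (∑ j ∈ s, t j) := by
  obtain ⟨m, hm, hmax⟩ := Finset.exists_max_image s (fun j => w (t j)) ⟨i, hi⟩
  refine (hmax i hi).trans ?_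
  by_cases h0 : t m = 0
  · simp [h0]
  rw [← Finset.add_sum_erase s t hm]
  refine (w.map_add_eq_of_lt_left ?_).ge
  refine w.map_sum_lt (by simpa using h0) fun j hj => ?_
  exact lt_of_le_of_ne (hmax j (Finset.mem_of_mem_erase hj))
    (ht m hm j (Finset.mem_of_mem_erase hj) (Finset.ne_of_mem_erase hj).symm h0).symm

/-- Products of elements with independent residues and elements with values in distinct cosets
form an orthogonal family. -/
theorem isOrthogonal_mul_of_independent {κ : Type*} [Fintype κ] {x : ι → M} {y : κ → M}
    (hx1 : ∀ i, w (x i) = 1)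
    (hx : ∀ a : ι → k, (∀ i, w (a i) ≤ 1) → w (∑ i, (a i : M) * x i) < 1 → ∀ i, w (a i) < 1)
    (hy0 : ∀ j, y j ≠ 0)
    (hy : ∀ i j, i ≠ j → ∀ c : k, w (y i) ≠ w (c * y j)) :
    IsOrthogonal k w (fun q : ι × κ => x q.1 * y q.2) := by
  have hxmax : ∀ a : ι → k, (∀ i, w (a i) ≤ w (∑ i, (a i : M) * x i)) ∧
      ∃ c : k, w (∑ i, (a i : M) * x i) = w c := by
    intro a
    by_cases h0 : ∀ i, a i = 0
    · exact ⟨fun i => by simp [h0], 0, by simp [h0]⟩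
    push Not at h0
    obtain ⟨i₀, hi₀⟩ := h0
    obtain ⟨m, -, hm⟩ := Finset.exists_max_image Finset.univ (fun i => w (a i))
      ⟨i₀, Finset.mem_univ _⟩
    have ham : (a m : M) ≠ 0 := by
      intro h0
      have := hm i₀ (Finset.mem_univ _)
      simp only [h0, map_zero, le_zero_iff, map_eq_zero, ZeroMemClass.coe_eq_zero] at this
      exact hi₀ this
    have hwm : w (a m) ≠ 0 := by simpa using ham
    have hge : w (a m) ≤ w (∑ i, (a i : M) * x i) := by
      by_contra hlt
      rw [not_le] at hlt
      have := hx (fun i => a i / a m) (fun i => by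
        simpa using div_le_one_of_le₀ (hm i (Finset.mem_univ _)) zero_le) (by
        have e : ∑ i, ((a i / a m : k) : M) * x i = (∑ i, (a i : M) * x i) / a m := by
          rw [Finset.sum_div]
          exact Finset.sum_congr rfl fun i _ => by push_cast; ring
        rw [e, map_div₀]
        exact (div_lt_one₀ (zero_lt_iff.2 hwm)).2 hlt) m
      simp [ham] at this
    refine ⟨fun i => (hm i (Finset.mem_univ _)).trans hge, a m, le_antisymm ?_ hge⟩
    refine w.map_sum_le fun i _ => ?_
    rw [map_mul, hx1, mul_one]
    exact hm i (Finset.mem_univ _)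
  refine ⟨fun q => mul_ne_zero (fun h0 => by simpa [h0] using hx1 q.1) (hy0 _), fun a q => ?_⟩
  have e : ∑ q : ι × κ, (a q : M) * (x q.1 * y q.2) =
      ∑ j, (∑ i, (a (i, j) : M) * x i) * y j := by
    rw [Fintype.sum_prod_type_right]
    refine Finset.sum_congr rfl fun j _ => ?_
    rw [Finset.sum_mul]
    exact Finset.sum_congr rfl fun i _ => by ring
  rw [e]
  refine le_trans ?_ (valuation_le_sum_of_injOn Finset.univ
    (fun j => (∑ i, (a (i, j) : M) * x i) * y j) ?_ (Finset.mem_univ q.2))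
  · rw [map_mul, map_mul, hx1, one_mul, map_mul]
    exact mul_le_mul_left ((hxmax fun i => a (i, q.2)).1 q.1) _
  · intro i _ j _ hij h0 heq
    obtain ⟨c, hc⟩ := (hxmax fun l => a (l, i)).2
    obtain ⟨d, hd⟩ := (hxmax fun l => a (l, j)).2
    have hc0 : w c ≠ 0 := by
      rw [← hc]
      exact (w.ne_zero_iff).2 (left_ne_zero_of_mul h0)
    rw [map_mul, map_mul, hc, hd] at heq
    refine hy i j hij (d / c) ?_
    push_cast
    rw [map_mul, map_div₀, div_mul_eq_mul_div, eq_div_iff hc0, ← heq, mul_comm]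

end Orthogonal

section Extension

variable {A : ValuationSubring K} {B : ValuationSubring L} [Algebra K L]

/-- The algebra structure on the residue field of `B` over that of `A` used in `residueDegree`. -/
abbrev residueAlgebra (h : B.comap (algebraMap K L) = A) :
    Algebra (IsLocalRing.ResidueField A) (IsLocalRing.ResidueField B) :=
  let _ := valHom_isLocalHom A B h
  (IsLocalRing.ResidueField.map (valHom A B h)).toAlgebra

theorem residueAlgebra_smul (h : B.comap (algebraMap K L) = A) (a : A) (x : B) :
    letI := residueAlgebra h
    IsLocalRing.residue A a • IsLocalRing.residue B x =
      IsLocalRing.residue B (valHom A B h a * x) := by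
  let _ := residueAlgebra h
  rw [Algebra.smul_def, map_mul]
  rfl

theorem valuation_algebraMap_le_one_iff (h : B.comap (algebraMap K L) = A) (a : K) :
    B.valuation (algebraMap K L a) ≤ 1 ↔ a ∈ A := by
  rw [ValuationSubring.valuation_le_one_iff, ← h, ValuationSubring.mem_comap]

theorem residue_eq_zero_iff (x : B) : IsLocalRing.residue B x = 0 ↔ B.valuation (x : L) < 1 := by
  rw [IsLocalRing.residue_eq_zero_iff, ValuationSubring.valuation_lt_one_iff]

theorem residue_eq_zero_iff_algebraMap (h : B.comap (algebraMap K L) = A) (a : A) :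
    IsLocalRing.residue A a = 0 ↔ B.valuation (algebraMap K L a) < 1 := by
  let _ := residueAlgebra h
  rw [← map_eq_zero_iff (algebraMap (IsLocalRing.ResidueField A) (IsLocalRing.ResidueField B))
    (RingHom.injective _)]
  exact residue_eq_zero_iff (valHom A B h a)

theorem linearIndependent_residue_iff (h : B.comap (algebraMap K L) = A) {ι : Type*} [Fintype ι]
    (x : ι → B) :
    letI := residueAlgebra h
    (LinearIndependent (IsLocalRing.ResidueField A) fun i => IsLocalRing.residue B (x i)) ↔
    ∀ a : ι → (algebraMap K L).fieldRange, (∀ i, B.valuation (a i : L) ≤ 1) →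
      B.valuation (∑ i, (a i : L) * x i) < 1 → ∀ i, B.valuation (a i : L) < 1 := by
  let _ := residueAlgebra h
  have key : ∀ c : ι → A, ∑ i, IsLocalRing.residue A (c i) • IsLocalRing.residue B (x i) =
      IsLocalRing.residue B (∑ i, valHom A B h (c i) * x i) := fun c => by
    rw [map_sum]
    exact Finset.sum_congr rfl fun i _ => residueAlgebra_smul h _ _
  have key2 : ∀ c : ι → A, ((∑ i, valHom A B h (c i) * x i : B) : L) =
      ∑ i, algebraMap K L (c i) * x i := fun c => by
    push_cast
    rfl
  rw [Fintype.linearIndependent_iff]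
  constructor
  · intro hli a ha hlt i
    choose c hc using fun i => (a i).2
    have hcA : ∀ i, c i ∈ A := fun i => by
      rw [← valuation_algebraMap_le_one_iff h, hc]
      exact ha i
    rw [← hc, ← residue_eq_zero_iff_algebraMap h ⟨c i, hcA i⟩]
    refine hli (fun i => IsLocalRing.residue A ⟨c i, hcA i⟩) ?_ i
    rw [key fun i => ⟨c i, hcA i⟩, residue_eq_zero_iff, key2]
    simpa only [hc] using hlt
  · intro hx g hg i
    choose c hc using fun i => IsLocalRing.residue_surjective (R := A) (g i)
    obtain rfl : (fun i => IsLocalRing.residue A (c i)) = g := funext hc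
    rw [key, residue_eq_zero_iff, key2] at hg
    rw [residue_eq_zero_iff_algebraMap h]
    exact hx (fun i => ⟨algebraMap K L (c i), c i, rfl⟩)
      (fun i => (valuation_algebraMap_le_one_iff h _).2 (c i).2) hg i

/-- The class of a unit of `L` in `vL / vK`. -/
def valueClass (K : Type u) {L : Type v} [Field K] [Field L] [Algebra K L]
    (B : ValuationSubring L) (x : Lˣ) :
    (Lˣ ⧸ B.unitGroup) ⧸ (Subgroup.map (QuotientGroup.mk' B.unitGroup)
      (MonoidHom.range (Units.map (algebraMap K L).toMonoidHom))) :=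
  QuotientGroup.mk (QuotientGroup.mk x)

theorem valueClass_surjective : Function.Surjective (valueClass K B) :=
  (QuotientGroup.mk_surjective).comp (QuotientGroup.mk_surjective)

theorem valueClass_eq_iff (x y : Lˣ) : valueClass K B x = valueClass K B y ↔
    ∃ c : (algebraMap K L).fieldRange, B.valuation (x : L) = B.valuation ((c : L) * (y : L)) := by
  have hval : ∀ u v : Lˣ, (QuotientGroup.mk u : Lˣ ⧸ B.unitGroup) = QuotientGroup.mk v ↔
      B.valuation (u : L) = B.valuation (v : L) := fun u v => by
    rw [QuotientGroup.eq, ValuationSubring.mem_unitGroup_iff]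
    have hu : B.valuation (u : L) ≠ 0 := by simp
    push_cast
    rw [map_mul, map_inv₀, inv_mul_eq_one₀ hu]
  rw [eq_comm, valueClass, valueClass, QuotientGroup.eq, Subgroup.mem_map]
  constructor
  · rintro ⟨_, ⟨c, rfl⟩, hc⟩
    refine ⟨⟨algebraMap K L c, c, rfl⟩, ?_⟩
    rw [QuotientGroup.mk'_apply, ← QuotientGroup.mk_inv, ← QuotientGroup.mk_mul, hval] at hc
    have hy : B.valuation (y : L) ≠ 0 := by simp
    rw [map_mul]
    have : B.valuation (algebraMap K L c) = (B.valuation (y : L))⁻¹ * B.valuation (x : L) := by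
      simpa using hc
    rw [this]
    field_simp
  · rintro ⟨⟨_, c, rfl⟩, hc⟩
    have hc0 : c ≠ 0 := by
      rintro rfl
      simp at hc
    refine ⟨_, ⟨Units.mk0 c hc0, rfl⟩, ?_⟩
    rw [QuotientGroup.mk'_apply, ← QuotientGroup.mk_inv, ← QuotientGroup.mk_mul, hval]
    have hy : B.valuation (y : L) ≠ 0 := by simp
    rw [map_mul] at hc
    simp only [RingHom.toMonoidHom_eq_coe, Units.coe_map, MonoidHom.coe_coe, Units.val_mk0,
      Units.val_mul, Units.val_inv_eq_inv_val, map_mul, map_inv₀, hc]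
    field_simp

theorem ramIndex_eq_card : ramIndex K B = Nat.card (Set.range (valueClass K B)) := by
  rw [valueClass_surjective.range_eq, Nat.card_congr (Equiv.Set.univ _)]
  rfl

theorem finrank_fieldRange_algebraMap :
    Module.finrank (algebraMap K L).fieldRange L = Module.finrank K L := by
  refine (Algebra.finrank_eq_of_equiv_equiv
    (RingEquiv.ofBijective (algebraMap K L).rangeRestrictField
      ⟨(algebraMap K L).rangeRestrictField.injective,
        fun ⟨_, c, hc⟩ => ⟨c, Subtype.ext hc⟩⟩) (RingEquiv.refl L) ?_).symm
  ext
  rfl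

theorem isOrthogonal_of_linearIndependent_residue (h : B.comap (algebraMap K L) = A)
    {ι κ : Type*} [Fintype ι] [Fintype κ] {x : ι → B} {y : κ → Lˣ}
    (hx : letI := residueAlgebra h
      LinearIndependent (IsLocalRing.ResidueField A) fun i => IsLocalRing.residue B (x i))
    (hy : Function.Injective fun j => valueClass K B (y j)) :
    IsOrthogonal (algebraMap K L).fieldRange B.valuation
      (fun q : ι × κ => (x q.1 : L) * (y q.2 : L)) := by
  refine isOrthogonal_mul_of_independent (x := fun i => (x i : L)) (y := fun j => (y j : L))
    (fun i => ?_) ((linearIndependent_residue_iff h x).1 hx) (fun j => (y j).ne_zero)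
    fun i j hij c hc => hij (hy ((valueClass_eq_iff _ _).2 ⟨c, hc⟩))
  let _ := residueAlgebra h
  refine (B.valuation_le_one (x i)).eq_or_lt.resolve_right fun hlt => ?_
  exact hx.ne_zero i ((residue_eq_zero_iff _).2 hlt)

/-- The fundamental inequality, for finite families. -/
theorem card_mul_card_le_finrank [FiniteDimensional K L] (h : B.comap (algebraMap K L) = A)
    {ι κ : Type*} [Fintype ι] [Fintype κ] {x : ι → B} {y : κ → Lˣ}
    (hx : letI := residueAlgebra h
      LinearIndependent (IsLocalRing.ResidueField A) fun i => IsLocalRing.residue B (x i))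
    (hy : Function.Injective fun j => valueClass K B (y j)) :
    Fintype.card ι * Fintype.card κ ≤ Module.finrank K L := by
  have hpos : 0 < Module.finrank K L := Module.finrank_pos
  rw [← finrank_fieldRange_algebraMap] at hpos ⊢
  have := Module.finite_of_finrank_pos hpos
  rw [← Fintype.card_prod]
  exact (isOrthogonal_of_linearIndependent_residue h hx hy).linearIndependent.fintype_card_le_finrank

theorem finite_residueField [FiniteDimensional K L] (h : B.comap (algebraMap K L) = A) :
    letI := residueAlgebra h
    Module.Finite (IsLocalRing.ResidueField A) (IsLocalRing.ResidueField B) := by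
  let _ := residueAlgebra h
  rw [← Module.rank_lt_aleph0_iff]
  refine lt_of_le_of_lt (rank_le (n := Module.finrank K L) fun s hs => ?_)
    (Cardinal.natCast_lt_aleph0)
  choose x hx using fun i : s => IsLocalRing.residue_surjective (R := B) (i : IsLocalRing.ResidueField B)
  have := card_mul_card_le_finrank h (x := x) (y := fun _ : Unit => (1 : Lˣ))
    (by simpa only [hx] using hs) (Function.injective_of_subsingleton _)
  simpa using this

theorem finite_range_valueClass [FiniteDimensional K L] (h : B.comap (algebraMap K L) = A) :
    Finite (Set.range (valueClass K B)) := by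
  by_contra hinf
  rw [not_finite_iff_infinite] at hinf
  obtain ⟨s, hs⟩ := Infinite.exists_subset_card_eq (Set.range (valueClass K B))
    (Module.finrank K L + 1)
  choose y hy using fun i : s => (i : Set.range (valueClass K B)).2
  let _ := residueAlgebra h
  have := card_mul_card_le_finrank h (x := fun _ : Unit => (1 : B)) (y := y)
    (by simp) (fun i j hij => by
      simp only [hy] at hij
      exact Subtype.ext (Subtype.ext hij))
  rw [Fintype.card_coe, hs] at this
  simp at this

theorem residueDegree_eq (h : B.comap (algebraMap K L) = A) : residueDegree A B =
    (letI := residueAlgebra h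
     Module.finrank (IsLocalRing.ResidueField A) (IsLocalRing.ResidueField B)) :=
  dif_pos h

/-- An orthogonal family of size `(vL : vK) · [Lv : Kv]`. -/
theorem exists_isOrthogonal [FiniteDimensional K L] (h : B.comap (algebraMap K L) = A) :
    ∃ z : Fin (residueDegree A B) × Fin (ramIndex K B) → L,
      IsOrthogonal (algebraMap K L).fieldRange B.valuation z := by
  let _ := residueAlgebra h
  have := finite_residueField h
  have := finite_range_valueClass h
  rw [residueDegree_eq h, ramIndex_eq_card]
  let β := Module.finBasis (IsLocalRing.ResidueField A) (IsLocalRing.ResidueField B)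
  choose x hx using fun i => IsLocalRing.residue_surjective (R := B) (β i)
  let e := Finite.equivFin (Set.range (valueClass K B))
  choose y hy using fun i => (e.symm i).2
  refine ⟨_, isOrthogonal_of_linearIndependent_residue h (x := x) (y := y) ?_ fun i j hij => ?_⟩
  · simpa only [hx] using β.linearIndependent
  · simp only [hy] at hij
    exact e.symm.injective (Subtype.ext hij)

theorem card_le_of_isOrthogonal [FiniteDimensional K L] (h : B.comap (algebraMap K L) = A)
    {ι : Type*} [Fintype ι] {z : ι → L}
    (hz : IsOrthogonal (algebraMap K L).fieldRange B.valuation z) :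
    Fintype.card ι ≤ ramIndex K B * residueDegree A B := by
  let _ := residueAlgebra h
  have := finite_residueField h
  have := finite_range_valueClass h
  have := Fintype.ofFinite (Set.range (valueClass K B))
  rw [residueDegree_eq h, ramIndex_eq_card, Nat.card_eq_fintype_card, mul_comm]
  let u : ι → Lˣ := fun i => Units.mk0 (z i) (hz.ne_zero i)
  let q : ι → Set.range (valueClass K B) := fun i => ⟨valueClass K B (u i), u i, rfl⟩
  refine Finset.card_le_mul_card_image_of_maps_to (f := q) (s := Finset.univ) (t := Finset.univ)
    (fun _ _ => Finset.mem_univ _) _ fun b _ => ?_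
  set F := Finset.univ.filter fun i => q i = b with hF
  by_cases hne : F = ∅
  · simp [hne]
  obtain ⟨i₀, hi₀⟩ := Finset.nonempty_iff_ne_empty.2 hne
  have hq : ∀ i : F, q i = b := fun i => (Finset.mem_filter.1 i.2).2
  have hc : ∀ i : F, ∃ c : (algebraMap K L).fieldRange,
      B.valuation (z i) = B.valuation ((c : L) * z i₀) := fun i =>
    (valueClass_eq_iff (u i) (u i₀)).1
      (congrArg Subtype.val ((hq i).trans (hq ⟨i₀, hi₀⟩).symm))
  choose c hc using hc
  have hz0 : ∀ i, B.valuation (z i) ≠ 0 := fun i => by simpa using hz.ne_zero i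
  have hc0 : ∀ i, (c i : L) ≠ 0 := fun i h0 => hz0 i (by rw [hc, h0]; simp)
  have hx1 : ∀ i : F, B.valuation (z i / (c i * z i₀)) = 1 := fun i => by
    rw [map_div₀, ← hc, div_self (hz0 i)]
  have hli := (linearIndependent_residue_iff h
    (fun i : F => ⟨z i / (c i * z i₀), (B.valuation_le_one_iff _).1 (hx1 i).le⟩)).2 ?_
  · have := hli.fintype_card_le_finrank
    rwa [Fintype.card_coe] at this
  intro a _ hlt i
  have e : ∑ i : F, (a i : L) * (z i / (c i * z i₀)) =
      (∑ j, ((if hj : j ∈ F then a ⟨j, hj⟩ / c ⟨j, hj⟩ else 0 : (algebraMap K L).fieldRange) : L) *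
        z j) / z i₀ := by
    rw [Finset.sum_div, ← Finset.sum_subset (Finset.subset_univ F), ← Finset.sum_coe_sort F]
    · refine Finset.sum_congr rfl fun i _ => ?_
      rw [dif_pos i.2]
      push_cast
      field_simp
    · intro j _ hj
      simp [dif_neg hj]
  simp only at hlt
  rw [e, map_div₀, div_lt_one₀ (zero_lt_iff.2 (hz0 i₀))] at hlt
  have h2 := (hz.le (fun j => if hj : j ∈ F then a ⟨j, hj⟩ / c ⟨j, hj⟩ else 0) i).trans_lt hlt
  rw [dif_pos i.2, map_mul, hc] at h2
  have hci := hc0 i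
  have e2 : (a i : L) * z i₀ = ((a i / c i : (algebraMap K L).fieldRange) : L) * (c i * z i₀) := by
    push_cast
    field_simp
  rw [← map_mul, ← e2, map_mul] at h2
  exact (mul_lt_iff_lt_one_left (zero_lt_iff.2 (hz0 i₀))).1 h2

/-- A finite extension is defectless if and only if it has an orthogonal basis. -/
theorem isDefectless_iff_exists_isOrthogonal [FiniteDimensional K L]
    (h : B.comap (algebraMap K L) = A) :
    IsDefectless A B ↔ ∃ (n : ℕ) (z : Fin n → L),
      IsOrthogonal (algebraMap K L).fieldRange B.valuation z ∧
      Submodule.span (algebraMap K L).fieldRange (Set.range z) = ⊤ := by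
  have hpos : 0 < Module.finrank (algebraMap K L).fieldRange L := by
    rw [finrank_fieldRange_algebraMap]
    exact Module.finrank_pos
  have := Module.finite_of_finrank_pos hpos
  obtain ⟨y, hy⟩ := exists_isOrthogonal h
  rw [IsDefectless, ← finrank_fieldRange_algebraMap]
  constructor
  · intro hd
    let e := (finProdFinEquiv (m := residueDegree A B) (n := ramIndex K B)).symm
    refine ⟨_, y ∘ e, ⟨fun i => hy.ne_zero _, fun a i => ?_⟩, ?_⟩
    · have := hy.le (a ∘ e.symm) (e i)
      rw [← e.sum_comp] at this
      simpa using this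
    · rw [e.surjective.range_comp]
      refine hy.linearIndependent.span_eq_top_of_card_eq_finrank' ?_
      rw [hd]
      simp [mul_comm]
  · rintro ⟨n, z, hz, hspan⟩
    apply le_antisymm
    · refine le_trans ?_ (card_le_of_isOrthogonal h hz)
      rw [← finrank_span_eq_card hz.linearIndependent, hspan, finrank_top]
    · have := hy.linearIndependent.fintype_card_le_finrank
      simpa [mul_comm] using this

end Extension

section PthPowers

theorem IsOrthogonal.comp_equiv {M : Type*} [Field M] {Γ : Type*}
    [LinearOrderedCommGroupWithZero Γ] {k : Subfield M} {w : Valuation M Γ} {ι κ : Type*}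
    [Fintype ι] [Fintype κ] {z : ι → M} (h : IsOrthogonal k w z) (e : κ ≃ ι) :
    IsOrthogonal k w (z ∘ e) := by
  refine ⟨fun i => h.ne_zero _, fun a i => ?_⟩
  have := h.le (a ∘ e.symm) (e i)
  rw [← e.sum_comp] at this
  simpa using this

theorem isOrthogonal_one {M : Type*} [Field M] {Γ : Type*} [LinearOrderedCommGroupWithZero Γ]
    (k : Subfield M) (w : Valuation M Γ) : IsOrthogonal k w (fun _ : Unit => (1 : M)) :=
  ⟨fun _ => one_ne_zero, fun a _ => by simp⟩

theorem fieldRange_algebraMap_subfield (E : Subfield K) : (algebraMap E K).fieldRange = E := by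
  ext x
  exact ⟨fun ⟨c, hc⟩ => hc ▸ c.2, fun hx => ⟨⟨x, hx⟩, rfl⟩⟩

variable {p : ℕ} (hp : p.Prime) {A : ValuationSubring K}

include hp in
theorem valuation_pow_le_pow_iff (n : ℕ) (x y : K) :
    A.valuation (x ^ p ^ n) ≤ A.valuation (y ^ p ^ n) ↔ A.valuation x ≤ A.valuation y := by
  rw [map_pow, map_pow, pow_le_pow_iff_left₀ zero_le zero_le (pow_ne_zero _ hp.ne_zero)]

include hp in
theorem isOrthogonal_pow_of_valuation_notMem {E : Subfield K} {c : K} (hc0 : c ≠ 0)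
    (hcp : c ^ p ∈ E) (hc : ∀ d ∈ E, A.valuation c ≠ A.valuation d) :
    IsOrthogonal E A.valuation (fun q : Unit × Fin p => (1 : K) * c ^ (q.2 : ℕ)) := by
  refine isOrthogonal_mul_of_independent (x := fun _ => (1 : K)) (y := fun i : Fin p => c ^ (i : ℕ))
    (by simp) (fun a _ h i => by simpa using h) (fun i => pow_ne_zero _ hc0) fun i j hij e he => ?_
  have hv0 : A.valuation c ≠ 0 := by simpa using hc0
  have hcop : IsCoprime ((p : ℤ)) ((i : ℤ) - (j : ℤ)) := by
    rw [(Nat.prime_iff_prime_int.1 hp).irreducible.coprime_iff_not_dvd]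
    intro hdvd
    have hlt : |(i : ℤ) - (j : ℤ)| < p := by
      rw [abs_lt]
      have := i.2
      have := j.2
      omega
    have := Int.eq_zero_of_abs_lt_dvd hdvd hlt
    exact hij (Fin.ext (by omega))
  obtain ⟨s, r, hsr⟩ := hcop
  have he' : A.valuation c ^ ((i : ℤ) - (j : ℤ)) = A.valuation e := by
    rw [zpow_sub₀ hv0, zpow_natCast, zpow_natCast, div_eq_iff (pow_ne_zero _ hv0), ← map_pow,
      he, map_mul, map_pow]
  refine hc ((c ^ p) ^ s * (e : K) ^ r) (mul_mem (zpow_mem hcp s) (zpow_mem e.2 r)) ?_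
  rw [map_mul, map_zpow₀, map_zpow₀, map_pow, ← he', ← zpow_natCast, ← zpow_mul, ← zpow_mul,
    ← zpow_add₀ hv0, mul_comm (p : ℤ), mul_comm _ r, hsr, zpow_one]

include hp in
theorem isOrthogonal_pow_of_residue_notMem [CharP K p] {E : Subfield K} {u : K}
    (hu1 : A.valuation u = 1) (hup : u ^ p ∈ E) (hu : ∀ d ∈ E, 1 ≤ A.valuation (u - d)) :
    IsOrthogonal E A.valuation (fun q : Fin p × Unit => u ^ (q.1 : ℕ) * (1 : K)) := by
  have : Fact p.Prime := ⟨hp⟩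
  have h : A.comap (algebraMap E K) = A.comap (algebraMap E K) := rfl
  let _ := residueAlgebra h
  have huA : u ∈ A := (A.valuation_le_one_iff _).1 hu1.le
  let u' : A := ⟨u, huA⟩
  let s : A.comap (algebraMap E K) := ⟨⟨u ^ p, hup⟩, pow_mem huA p⟩
  have hroot : IsLocalRing.residue A u' ^ p =
      algebraMap (IsLocalRing.ResidueField (A.comap (algebraMap E K)))
        (IsLocalRing.ResidueField A) (IsLocalRing.residue _ s) := by
    rw [← map_pow]
    rfl
  have hirr := X_pow_sub_C_irreducible_of_prime hp (a := IsLocalRing.residue _ s) fun b hb => by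
    obtain ⟨x, rfl⟩ := IsLocalRing.residue_surjective b
    rw [← sub_eq_zero, ← map_pow, ← map_sub, residue_eq_zero_iff_algebraMap h] at hb
    have hd := hu x x.1.2
    have e : algebraMap E K ((x ^ p - s : A.comap (algebraMap E K)) : E) = -((u - (x : E)) ^ p) := by
      rw [sub_pow_char]
      simp only [AddSubgroupClass.coe_sub, SubmonoidClass.coe_pow, map_sub, map_pow, neg_sub]
      rfl
    rw [e, Valuation.map_neg, map_pow] at hb
    exact absurd hb (one_le_pow₀ hd).not_gt
  have hmin := minpoly.eq_of_irreducible_of_monic hirr (x := IsLocalRing.residue A u')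
    (by simp [hroot]) (Polynomial.monic_X_pow_sub_C _ hp.ne_zero)
  have hdeg : p = (minpoly (IsLocalRing.ResidueField (A.comap (algebraMap E K)))
      (IsLocalRing.residue A u')).natDegree := by
    rw [← hmin, Polynomial.natDegree_X_pow_sub_C]
  have hli := (linearIndependent_pow (K := IsLocalRing.ResidueField (A.comap (algebraMap E K)))
    (IsLocalRing.residue A u')).comp (Fin.cast hdeg) (Fin.cast_injective hdeg)
  have := isOrthogonal_of_linearIndependent_residue h (x := fun i : Fin p => u' ^ (i : ℕ))
    (y := fun _ : Unit => (1 : Kˣ)) (by simpa [Function.comp_def] using hli)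
    (Function.injective_of_subsingleton _)
  rw [fieldRange_algebraMap_subfield] at this
  simpa using this

include hp in
theorem mem_span_pow_of_mem_adjoin {E : Subfield K} {u : K} (hup : u ^ p ∈ E) {x : K}
    (hx : x ∈ IntermediateField.adjoin E {u}) :
    x ∈ Submodule.span E (Set.range fun i : Fin p => u ^ (i : ℕ)) := by
  let g : Polynomial E := Polynomial.X ^ p - Polynomial.C ⟨u ^ p, hup⟩
  have hg : g.Monic := Polynomial.monic_X_pow_sub_C _ hp.ne_zero
  have hgu : Polynomial.aeval u g = 0 := by
    simp only [g, map_sub, map_pow, Polynomial.aeval_X, Polynomial.aeval_C]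
    exact sub_self _
  have hint : IsAlgebraic E u := ⟨g, hg.ne_zero, hgu⟩
  rw [← IntermediateField.mem_toSubalgebra,
    IntermediateField.adjoin_simple_toSubalgebra_of_isAlgebraic hint,
    Algebra.adjoin_singleton_eq_range_aeval] at hx
  obtain ⟨f, rfl⟩ := hx
  have hdeg : (f %ₘ g).natDegree < p := by
    have := Polynomial.natDegree_modByMonic_lt f hg (fun h1 => by
      have := congrArg Polynomial.natDegree h1
      rw [Polynomial.natDegree_X_pow_sub_C, Polynomial.natDegree_one] at this
      exact hp.ne_zero this)
    rwa [Polynomial.natDegree_X_pow_sub_C] at this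
  change Polynomial.aeval u f ∈ _
  rw [← Polynomial.aeval_modByMonic_eq_self_of_root hgu, Polynomial.aeval_eq_sum_range' hdeg]
  refine Submodule.sum_mem _ fun i hi => Submodule.smul_mem _ _ (Submodule.subset_span ?_)
  exact ⟨⟨i, Finset.mem_range.1 hi⟩, rfl⟩

include hp in
/-- If `b` has a best approximation in a subfield `E ⊇ K^p`, then `b` lies in a subfield having an
orthogonal basis over `E`. -/
theorem exists_isOrthogonal_of_best_approx [CharP K p] {E : Subfield K} (hE : ∀ x : K, x ^ p ∈ E)
    {b : K} (hb : b ∉ E)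
    (hbest : ∃ y ∈ E, ∀ x ∈ E, A.valuation (b - y) ≤ A.valuation (b - x)) :
    ∃ E' : Subfield K, E ≤ E' ∧ b ∈ E' ∧ ∃ (ι : Type) (_ : Fintype ι) (z : ι → K),
      IsOrthogonal E A.valuation z ∧ ∀ x, x ∈ Submodule.span E (Set.range z) ↔ x ∈ E' := by
  obtain ⟨y, hy, hbest⟩ := hbest
  have hc0 : b - y ≠ 0 := fun h0 => hb (sub_eq_zero.1 h0 ▸ hy)
  obtain ⟨u, ⟨d, hd, hdu⟩, ι, _, z, hz, hrange⟩ : ∃ u : K, (∃ d ∈ E, b - y = d * u) ∧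
      ∃ (ι : Type) (_ : Fintype ι) (z : ι → K), IsOrthogonal E A.valuation z ∧
        Set.range z = Set.range fun i : Fin p => u ^ (i : ℕ) := by
    by_cases hc : ∀ d ∈ E, A.valuation (b - y) ≠ A.valuation d
    · refine ⟨b - y, ⟨1, one_mem _, (one_mul _).symm⟩, _, _, _,
        isOrthogonal_pow_of_valuation_notMem hp hc0 (hE _) hc, ?_⟩
      ext x
      simp
    · push Not at hc
      obtain ⟨d, hd, hcd⟩ := hc
      have hd0 : d ≠ 0 := by
        rintro rfl
        rw [map_zero, map_eq_zero] at hcd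
        exact hc0 hcd
      have hvd : A.valuation d ≠ 0 := by simpa using hd0
      refine ⟨(b - y) / d, ⟨d, hd, by field_simp⟩, _, _, _,
        isOrthogonal_pow_of_residue_notMem hp (u := (b - y) / d) ?_ (hE _) fun e he => ?_, ?_⟩
      · rw [map_div₀, hcd, div_self hvd]
      · have e1 : (b - y) / d - e = (b - (y + e * d)) / d := by
          field_simp
          ring
        rw [e1, map_div₀, one_le_div₀ (zero_lt_iff.2 hvd), ← hcd]
        exact hbest _ (add_mem hy (mul_mem he hd))
      · ext x
        simp
  let E' : Subfield K := (IntermediateField.adjoin E {u}).toSubfield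
  have hEE' : E ≤ E' := fun x hx => (IntermediateField.adjoin E {u}).algebraMap_mem ⟨x, hx⟩
  have huE' : u ∈ E' := IntermediateField.mem_adjoin_simple_self E u
  refine ⟨E', hEE', ?_, ι, _, z, hz, fun x => ⟨fun hx => ?_, fun hx => ?_⟩⟩
  · have := add_mem (mul_mem (hEE' hd) huE') (hEE' hy)
    rwa [← hdu, sub_add_cancel] at this
  · have hle : Submodule.span E (Set.range z) ≤
        Subalgebra.toSubmodule (IntermediateField.adjoin E {u}).toSubalgebra := by
      rw [hrange, Submodule.span_le]
      rintro _ ⟨i, rfl⟩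
      exact pow_mem huE' _
    exact hle hx
  · rw [hrange]
    exact mem_span_pow_of_mem_adjoin hp (hE u) hx

theorem pow_mem_pPowerSubfield [CharP K p] (x : K) : x ^ p ∈ pPowerSubfield K p hp :=
  have : Fact p.Prime := ⟨hp⟩
  ⟨x, rfl⟩

theorem exists_pow_of_mem_pPowerSubfield [CharP K p] {x : K} (hx : x ∈ pPowerSubfield K p hp) :
    ∃ y, y ^ p = x := by
  have : Fact p.Prime := ⟨hp⟩
  obtain ⟨y, hy⟩ := hx
  exact ⟨y, hy⟩

/-- Extremality with respect to `b - ∑ bᵢ Xᵢ^p` means that `b` has a best approximation in the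
`K^p`-span of the `bᵢ`. -/
theorem kExtremalMv_iff_exists_best_approx [CharP K p] {n : ℕ} (b : K) (bv : Fin n → K) :
    KExtremalMv A (MvPolynomial.C b - ∑ i : Fin n,
        MvPolynomial.C (bv i) * (MvPolynomial.X i : MvPolynomial (Fin n) K) ^ p) ↔
      ∃ y ∈ Submodule.span (pPowerSubfield K p hp) (Set.range bv),
        ∀ x ∈ Submodule.span (pPowerSubfield K p hp) (Set.range bv),
          A.valuation (b - y) ≤ A.valuation (b - x) := by
  have heval : ∀ a : Fin n → K, MvPolynomial.eval a (MvPolynomial.C b - ∑ i : Fin n,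
      MvPolynomial.C (bv i) * (MvPolynomial.X i : MvPolynomial (Fin n) K) ^ p) =
      b - ∑ i, a i ^ p * bv i := fun a => by
    simp [mul_comm]
  have hmem : ∀ x, x ∈ Submodule.span (pPowerSubfield K p hp) (Set.range bv) ↔
      ∃ a : Fin n → K, ∑ i, a i ^ p * bv i = x := fun x => by
    rw [mem_span_range_iff_exists_coeff]
    constructor
    · rintro ⟨c, rfl⟩
      choose a ha using fun i => exists_pow_of_mem_pPowerSubfield hp (c i).2
      exact ⟨a, by simp [ha]⟩
    · rintro ⟨a, rfl⟩
      exact ⟨fun i => ⟨a i ^ p, pow_mem_pPowerSubfield hp _⟩, rfl⟩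
  simp only [KExtremalMv, heval, hmem]
  constructor
  · rintro ⟨a, ha⟩
    refine ⟨_, ⟨a, rfl⟩, ?_⟩
    rintro _ ⟨c, rfl⟩
    exact ha c
  · rintro ⟨_, ⟨a, rfl⟩, ha⟩
    exact ⟨a, fun c => ha _ ⟨c, rfl⟩⟩

theorem exists_subfield_isOrthogonal_of_extremal [CharP K p]
    (H : ∀ (n : ℕ) (b : K) (bv : Fin n → K),
        LinearIndependent (pPowerSubfield K p hp) bv →
        Submodule.span (pPowerSubfield K p hp) (Set.range bv) =
          Subalgebra.toSubmodule (Algebra.adjoin (pPowerSubfield K p hp) (Set.range bv)) →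
        KExtremalMv A (MvPolynomial.C b - ∑ i : Fin n,
          MvPolynomial.C (bv i) * (MvPolynomial.X i : MvPolynomial (Fin n) K) ^ p))
    (T : Finset K) :
    ∃ E : Subfield K, pPowerSubfield K p hp ≤ E ∧ (T : Set K) ⊆ E ∧
      ∃ (ι : Type) (_ : Fintype ι) (z : ι → K),
        IsOrthogonal (pPowerSubfield K p hp) A.valuation z ∧
        ∀ x, x ∈ Submodule.span (pPowerSubfield K p hp) (Set.range z) ↔ x ∈ E := by
  induction T using Finset.induction_on with
  | empty =>
    refine ⟨_, le_rfl, by simp, Unit, _, _, isOrthogonal_one _ _, fun x => ?_⟩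
    rw [mem_span_range_iff_exists_coeff]
    constructor
    · rintro ⟨a, rfl⟩
      simp
    · intro hx
      exact ⟨fun _ => ⟨x, hx⟩, by simp⟩
  | insert b T _ ih =>
    obtain ⟨E, hkE, hTE, ι, _, z, hz, hspan⟩ := ih
    by_cases hb : b ∈ E
    · refine ⟨E, hkE, ?_, ι, _, z, hz, hspan⟩
      rw [Finset.coe_insert]
      exact Set.insert_subset hb hTE
    let e := (Fintype.equivFin ι).symm
    have hrange : Set.range (z ∘ e) = Set.range z := e.surjective.range_comp z
    have hext := H _ b (z ∘ e) (hz.comp_equiv e).linearIndependent (by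
      rw [hrange]
      refine le_antisymm (Algebra.span_le_adjoin _ _) fun x hx => ?_
      rw [hspan]
      rw [Subalgebra.mem_toSubmodule] at hx
      induction hx using Algebra.adjoin_induction with
      | mem x hx => exact (hspan x).1 (Submodule.subset_span hx)
      | algebraMap r => exact hkE r.2
      | add x y _ _ hx hy => exact add_mem hx hy
      | mul x y _ _ hx hy => exact mul_mem hx hy)
    rw [kExtremalMv_iff_exists_best_approx hp, hrange] at hext
    simp only [hspan] at hext
    obtain ⟨E', hEE', hbE', κ, _, y, hy, hyspan⟩ := exists_isOrthogonal_of_best_approx hp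
      (fun x => hkE (pow_mem_pPowerSubfield hp x)) hb hext
    have hzE : ∀ i, z i ∈ E := fun i => (hspan _).1 (Submodule.subset_span ⟨i, rfl⟩)
    have hyE' : ∀ j, y j ∈ E' := fun j => (hyspan _).1 (Submodule.subset_span ⟨j, rfl⟩)
    refine ⟨E', hkE.trans hEE', ?_, ι × κ, _, _, hz.mul hzE hkE hy, fun x => ?_⟩
    · rw [Finset.coe_insert]
      exact Set.insert_subset hbE' fun t ht => hEE' (hTE ht)
    rw [mem_span_range_iff_exists_coeff]
    constructor
    · rintro ⟨a, rfl⟩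
      exact sum_mem fun q _ => mul_mem (hEE' (hkE (a q).2)) (mul_mem (hEE' (hzE _)) (hyE' _))
    · intro hx
      rw [← hyspan, mem_span_range_iff_exists_coeff] at hx
      obtain ⟨c, rfl⟩ := hx
      have hc := fun j => (hspan (c j : K)).2 (c j).2
      simp only [mem_span_range_iff_exists_coeff] at hc
      choose a ha using hc
      refine ⟨fun q => a q.2 q.1, ?_⟩
      rw [Fintype.sum_prod_type_right]
      refine Finset.sum_congr rfl fun j _ => ?_
      rw [← ha, Finset.sum_mul]
      exact Finset.sum_congr rfl fun i _ => by ring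

/-- If finite sets are covered by orthogonal families over `K^p`, then they are covered by
orthogonal families over `K^(p^m)` for all `m`. -/
theorem exists_isOrthogonal_iterateFrobenius [CharP K p] [Fact p.Prime]
    (H : ∀ T : Finset K, ∃ (ι : Type) (_ : Fintype ι) (z : ι → K),
      IsOrthogonal (pPowerSubfield K p hp) A.valuation z ∧
      (T : Set K) ⊆ Submodule.span (pPowerSubfield K p hp) (Set.range z))
    (m : ℕ) : ∀ T : Finset K, ∃ (ι : Type) (_ : Fintype ι) (z : ι → K),
      IsOrthogonal (iterateFrobenius K p m).fieldRange A.valuation z ∧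
      (T : Set K) ⊆ Submodule.span (iterateFrobenius K p m).fieldRange (Set.range z) := by
  induction m with
  | zero =>
    refine fun T => ⟨Unit, _, _, isOrthogonal_one _ _, fun x _ => ?_⟩
    rw [SetLike.mem_coe, mem_span_range_iff_exists_coeff]
    exact ⟨fun _ => ⟨x, x, by simp⟩, by simp⟩
  | succ m ih =>
    intro T
    obtain ⟨ι, _, z, hz, hT⟩ := H T
    have hcoeff : ∀ t : T, ∃ c : ι → K, ∑ i, c i ^ p * z i = t := fun t => by
      obtain ⟨a, ha⟩ := mem_span_range_iff_exists_coeff.1 (hT t.2)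
      choose c hc using fun i => exists_pow_of_mem_pPowerSubfield hp (a i).2
      exact ⟨c, by simp [hc, ha]⟩
    choose c hc using hcoeff
    obtain ⟨κ, _, y, hy, hcy⟩ := ih (Finset.univ.image fun q : T × ι => c q.1 q.2)
    have hmap : (iterateFrobenius K p (m + 1)).fieldRange =
        (iterateFrobenius K p m).fieldRange.map (frobenius K p) := by
      rw [RingHom.map_fieldRange]
      congr 1
      ext x
      simp [iterateFrobenius_def, frobenius_def, pow_succ, pow_mul]
    have hyp := (isOrthogonal_map_iff (frobenius K p) (fun a b => by
      simpa [frobenius_def] using valuation_pow_le_pow_iff hp (A := A) 1 a b)).2 hy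
    rw [← hmap] at hyp
    have hle : (iterateFrobenius K p (m + 1)).fieldRange ≤ pPowerSubfield K p hp := by
      rw [hmap]
      rintro _ ⟨x, -, rfl⟩
      exact pow_mem_pPowerSubfield hp x
    refine ⟨κ × ι, _, _, hyp.mul (fun j => pow_mem_pPowerSubfield hp _) hle hz, fun t ht => ?_⟩
    have hcmem : ∀ i, c ⟨t, ht⟩ i ∈
        Submodule.span (iterateFrobenius K p m).fieldRange (Set.range y) := fun i =>
      hcy (by simp only [Finset.coe_image, Finset.coe_univ, Set.image_univ]; exact ⟨(⟨t, ht⟩, i), rfl⟩)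
    simp only [mem_span_range_iff_exists_coeff] at hcmem
    choose a ha using hcmem
    rw [SetLike.mem_coe, mem_span_range_iff_exists_coeff]
    refine ⟨fun q => ⟨(a q.2 q.1 : K) ^ p, ?_⟩, ?_⟩
    · rw [hmap]
      exact ⟨_, (a q.2 q.1).2, rfl⟩
    · rw [Fintype.sum_prod_type_right]
      refine Eq.trans (Finset.sum_congr rfl fun i _ => ?_) (hc ⟨t, ht⟩)
      rw [← ha i, ← frobenius_def, map_sum, Finset.sum_mul]
      refine Finset.sum_congr rfl fun j _ => ?_
      simp only [frobenius_def, mul_pow]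
      ring

include hp in
/-- If finite sets are covered by orthogonal families over `K^(p^m)` for every `m`, then `K` is
inseparably defectless. -/
theorem isInsepDefectless_of_cover [CharP K p] [Fact p.Prime]
    (H : ∀ (m : ℕ) (T : Finset K), ∃ (ι : Type) (_ : Fintype ι) (z : ι → K),
      IsOrthogonal (iterateFrobenius K p m).fieldRange A.valuation z ∧
      (T : Set K) ⊆ Submodule.span (iterateFrobenius K p m).fieldRange (Set.range z)) :
    IsInsepDefectless A := by
  intro L _ _ _ _ B h
  rw [isDefectless_iff_exists_isOrthogonal h]
  let m := IsPurelyInseparable.exponent K L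
  let φ : L →+* K := IsPurelyInseparable.iterateFrobenius K L p (n := m) le_rfl
  have hφ : ∀ x, algebraMap K L (φ x) = x ^ p ^ m :=
    IsPurelyInseparable.algebraMap_iterateFrobenius K p le_rfl
  have hrange : (algebraMap K L).fieldRange.map φ = (iterateFrobenius K p m).fieldRange := by
    rw [RingHom.map_fieldRange]
    congr 1
    ext x
    exact IsPurelyInseparable.iterateFrobenius_algebraMap L p le_rfl x
  have hone : ∀ x, A.valuation (φ x) ≤ 1 ↔ B.valuation x ≤ 1 := fun x => by
    rw [ValuationSubring.valuation_le_one_iff, ← valuation_algebraMap_le_one_iff h, hφ]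
    simpa using valuation_pow_le_pow_iff hp (A := B) m x 1
  have hval : ∀ x y, A.valuation (φ x) ≤ A.valuation (φ y) ↔ B.valuation x ≤ B.valuation y := by
    intro x y
    by_cases hy : y = 0
    · simp [hy]
    have h1 : A.valuation (φ y) ≠ 0 := by simpa using hy
    have h2 : B.valuation y ≠ 0 := by simpa using hy
    rw [← div_le_one₀ (zero_lt_iff.2 h1), ← div_le_one₀ (zero_lt_iff.2 h2), ← map_div₀,
      ← map_div₀, ← map_div₀, hone]
  let β := Module.finBasis K L
  obtain ⟨ι, _, z, hz, hT⟩ := H m (Finset.univ.image fun i => φ (β i))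
  obtain ⟨z', J, hz', -, hJ⟩ := hz.exists_adapted _ hT
  have hβ : ∀ x, φ x ∈ Submodule.span (iterateFrobenius K p m).fieldRange (z' '' J) := fun x => by
    rw [hJ, ← β.sum_repr x, map_sum]
    refine Submodule.sum_mem _ fun i _ => ?_
    rw [Algebra.smul_def, map_mul, IsPurelyInseparable.iterateFrobenius_algebraMap L p le_rfl]
    exact Submodule.smul_mem _ (⟨_, β.repr x i, rfl⟩ : (iterateFrobenius K p m).fieldRange)
      (Submodule.subset_span (by simp))
  have hz'φ : ∀ j : J, ∃ ζ : L, φ ζ = z' j := fun j => by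
    have hj : z' j ∈ Submodule.span (iterateFrobenius K p m).fieldRange (z' '' J) :=
      Submodule.subset_span ⟨j, j.2, rfl⟩
    rw [hJ] at hj
    generalize z' j = x at hj
    induction hj using Submodule.span_induction with
    | mem x hx =>
      obtain ⟨i, -, rfl⟩ := Finset.mem_image.1 hx
      exact ⟨_, rfl⟩
    | zero => exact ⟨0, map_zero _⟩
    | add x y _ _ hx hy =>
      obtain ⟨a, rfl⟩ := hx
      obtain ⟨b, rfl⟩ := hy
      exact ⟨a + b, map_add _ _ _⟩
    | smul r x _ hx =>
      obtain ⟨a, rfl⟩ := hx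
      obtain ⟨_, c, rfl⟩ := r
      refine ⟨algebraMap K L c * a, ?_⟩
      rw [map_mul, IsPurelyInseparable.iterateFrobenius_algebraMap L p le_rfl]
      rfl
  choose ζ hζ using hz'φ
  have hζo : IsOrthogonal (algebraMap K L).fieldRange B.valuation ζ := by
    rw [← isOrthogonal_map_iff φ hval, hrange]
    simp only [hζ]
    refine ⟨fun j => hz'.ne_zero j, fun a j => ?_⟩
    have := hz'.le (fun i => if hi : i ∈ J then a ⟨i, hi⟩ else 0) j
    rw [← Finset.sum_subset (Finset.subset_univ J) (fun i _ hi => by simp [dif_neg hi]),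
      ← Finset.sum_coe_sort J] at this
    simpa using this
  let e := (Fintype.equivFin J).symm
  refine ⟨_, ζ ∘ e, hζo.comp_equiv e, ?_⟩
  rw [e.surjective.range_comp, eq_top_iff]
  intro x _
  have hx := hβ x
  have himg : z' '' J = Set.range fun j : J => z' j := by
    ext
    simp
  rw [himg, mem_span_range_iff_exists_coeff] at hx
  obtain ⟨a, ha⟩ := hx
  choose c hc using fun j => (a j).2
  rw [mem_span_range_iff_exists_coeff]
  refine ⟨fun j => ⟨algebraMap K L (c j), c j, rfl⟩, φ.injective ?_⟩
  rw [map_sum, ← ha]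
  refine Finset.sum_congr rfl fun j _ => ?_
  rw [map_mul, hζ, ← hc, IsPurelyInseparable.iterateFrobenius_algebraMap L p le_rfl]
  rfl

/-- Over an inseparably defectless field, finite sets are covered by orthogonal families over
`K^p`. -/
theorem IsInsepDefectless.exists_isOrthogonal [CharP K p] (hA : IsInsepDefectless A)
    (T : Finset K) : ∃ (n : ℕ) (z : Fin n → K),
      IsOrthogonal (pPowerSubfield K p hp) A.valuation z ∧
      (T : Set K) ⊆ Submodule.span (pPowerSubfield K p hp) (Set.range z) := by
  have : Fact p.Prime := ⟨hp⟩
  let k := pPowerSubfield K p hp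
  let F := IntermediateField.adjoin k (T : Set K)
  have : FiniteDimensional k F := by
    have : Finite (T : Set K) := T.finite_toSet
    refine IntermediateField.finiteDimensional_adjoin fun x _ => ?_
    exact IsIntegral.of_pow hp.pos
      (isIntegral_algebraMap (x := (⟨x ^ p, pow_mem_pPowerSubfield hp x⟩ : k)))
  let σ : K ≃+* k := RingEquiv.ofBijective (frobenius K p).rangeRestrictField
    ⟨(frobenius K p).rangeRestrictField.injective, fun ⟨_, c, hc⟩ => ⟨c, Subtype.ext hc⟩⟩
  let _ : Algebra K F := ((algebraMap k F).comp (σ : K →+* k)).toAlgebra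
  have halg : ∀ x : K, ((algebraMap K F x : F) : K) = x ^ p := fun x => rfl
  have hfin : FiniteDimensional K F := by
    refine Module.Finite.of_equiv_equiv (A₁ := k) (B₁ := F) σ.symm (RingEquiv.refl F) ?_
    ext x
    change ((algebraMap k F (σ (σ.symm x)) : F) : K) = _
    rw [RingEquiv.apply_symm_apply]
    rfl
  have hinsep : IsPurelyInseparable K F := by
    rw [isPurelyInseparable_iff_pow_mem K p]
    exact fun x => ⟨1, x, Subtype.ext (by rw [halg]; simp)⟩
  let B := A.comap (algebraMap F K)
  have h : B.comap (algebraMap K F) = A := by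
    ext x
    rw [ValuationSubring.mem_comap, ValuationSubring.mem_comap]
    change ((algebraMap K F x : F) : K) ∈ A ↔ _
    rw [halg, ← A.valuation_le_one_iff, ← A.valuation_le_one_iff]
    simpa using valuation_pow_le_pow_iff hp (A := A) 1 x 1
  obtain ⟨n, z, hz, hspan⟩ := (isDefectless_iff_exists_isOrthogonal h).1 (hA F hfin hinsep B h)
  have hval : ∀ x y : F, A.valuation (algebraMap F K x) ≤ A.valuation (algebraMap F K y) ↔
      B.valuation x ≤ B.valuation y := fun x y => by
    by_cases hy : y = 0
    · simp [hy]
    have h1 : A.valuation (algebraMap F K y) ≠ 0 := by simpa using hy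
    have h2 : B.valuation y ≠ 0 := by simpa using hy
    rw [← div_le_one₀ (zero_lt_iff.2 h1), ← div_le_one₀ (zero_lt_iff.2 h2), ← map_div₀,
      ← map_div₀, ← map_div₀, ValuationSubring.valuation_le_one_iff,
      ValuationSubring.valuation_le_one_iff, ValuationSubring.mem_comap]
  have hk : (algebraMap K F).fieldRange.map (algebraMap F K) = k := by
    rw [RingHom.map_fieldRange]
    rfl
  have hz' := (isOrthogonal_map_iff (algebraMap F K) hval).2 hz
  rw [hk] at hz'
  refine ⟨n, _, hz', fun t ht => ?_⟩
  have htF : (⟨t, IntermediateField.subset_adjoin k _ ht⟩ : F) ∈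
      Submodule.span (algebraMap K F).fieldRange (Set.range z) := by
    rw [hspan]
    trivial
  rw [mem_span_range_iff_exists_coeff] at htF
  obtain ⟨a, ha⟩ := htF
  rw [SetLike.mem_coe, mem_span_range_iff_exists_coeff]
  refine ⟨fun i => ⟨algebraMap F K (a i), ?_⟩, ?_⟩
  · have : algebraMap F K (a i) ∈ (algebraMap K F).fieldRange.map (algebraMap F K) :=
      ⟨_, (a i).2, rfl⟩
    rwa [hk] at this
  · have := congrArg (algebraMap F K) ha
    rw [map_sum] at this
    simpa using this

end PthPowers

/-- A valued field of characteristic `p > 0` is inseparably defectless if and only if it is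
`K`-extremal with respect to every polynomial `b - ∑ bᵢ Xᵢ^p` where `b₁, …, bₙ` form a
`K^p`-basis of a finite extension of `K^p` inside `K`. -/
theorem statement1 {K : Type u} [Field K] (p : ℕ) (hp : p.Prime) [CharP K p]
    (A : ValuationSubring K) :
    IsInsepDefectless A ↔
      ∀ (n : ℕ) (b : K) (bv : Fin n → K),
        LinearIndependent (pPowerSubfield K p hp) bv →
        Submodule.span (pPowerSubfield K p hp) (Set.range bv) =
          Subalgebra.toSubmodule (Algebra.adjoin (pPowerSubfield K p hp) (Set.range bv)) →
        KExtremalMv A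
          (MvPolynomial.C b - ∑ i : Fin n, MvPolynomial.C (bv i) * (MvPolynomial.X i : MvPolynomial (Fin n) K) ^ p) := by
  have : Fact p.Prime := ⟨hp⟩
  constructor
  · intro hA n b bv _ _
    rw [kExtremalMv_iff_exists_best_approx hp]
    obtain ⟨m, z, hz, hT⟩ := hA.exists_isOrthogonal hp (insert b (Finset.univ.image bv))
    rw [Finset.coe_insert, Set.insert_subset_iff] at hT
    simpa using hz.exists_best_approx _ hT.2 hT.1
  · intro H
    refine isInsepDefectless_of_cover hp
      (exists_isOrthogonal_iterateFrobenius hp fun T => ?_)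
    obtain ⟨E, -, hTE, ι, _, z, hz, hspan⟩ := exists_subfield_isOrthogonal_of_extremal hp H T
    exact ⟨ι, _, z, hz, fun t ht => (hspan t).2 (hTE ht)⟩

end ValuedDefect
end
end

section
/- A valued field (K,v) is algebraically maximal if and only if (K,v) is O-extremal with respect to every polynomial in one variable with coefficients in K. -/
open scoped Classical

noncomputable section

namespace ValuedDefect

universe u v

variable {K : Type u} {L : Type v} [Field K] [Field L]

open Polynomial IntermediateField

/-- A valuation subring extends along any homomorphism of fields. -/
theorem exists_valuationSubring_comap_eq (f : K →+* L) (A : ValuationSubring K) :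
    ∃ C : ValuationSubring L, C.comap f = A := by
  obtain ⟨C, hle, hloc⟩ := LocalSubring.exists_le_valuationSubring
    (LocalSubring.map f A.toLocalSubring)
  refine ⟨C, ?_⟩
  ext x
  rw [ValuationSubring.mem_comap]
  refine ⟨fun hx => ?_, fun hx => hle (Subring.mem_map.mpr ⟨x, hx, rfl⟩)⟩
  rcases A.mem_or_inv_mem x with h | h
  · exact h
  by_cases hx0 : x = 0
  · rw [hx0]; exact A.zero_mem
  have hfx : f x ≠ 0 := (map_ne_zero f).mpr hx0
  have hmem : f x⁻¹ ∈ (LocalSubring.map f A.toLocalSubring).toSubring :=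
    Subring.mem_map.mpr ⟨_, h, rfl⟩
  have hunit : IsUnit (Subring.inclusion hle ⟨f x⁻¹, hmem⟩) :=
    isUnit_iff_exists_inv.mpr ⟨⟨f x, hx⟩, Subtype.ext (by
      change f x⁻¹ * f x = 1
      rw [map_inv₀, inv_mul_cancel₀ hfx])⟩
  obtain ⟨⟨y, hy⟩, hxy⟩ := isUnit_iff_exists_inv.mp (hloc.map_nonunit _ hunit)
  obtain ⟨z, hz, rfl⟩ := Subring.mem_map.mp hy
  have h1 : f x⁻¹ * f z = 1 := congrArg Subtype.val hxy
  rw [map_inv₀, inv_mul_eq_one₀ hfx] at h1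
  rw [f.injective h1]
  exact hz

theorem valuation_le_iff_of_comap_eq {A : ValuationSubring K} {B : ValuationSubring L}
    {f : K →+* L} (h : B.comap f = A) (x y : K) :
    A.valuation x ≤ A.valuation y ↔ B.valuation (f x) ≤ B.valuation (f y) := by
  by_cases hy : y = 0
  · simp [hy]
  have hA : 0 < A.valuation y := (Valuation.pos_iff _).mpr hy
  have hB : 0 < B.valuation (f y) := (Valuation.pos_iff _).mpr ((map_ne_zero f).mpr hy)
  rw [← div_le_one₀ hA, ← div_le_one₀ hB, ← map_div₀, ← map_div₀, ← map_div₀,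
    ValuationSubring.valuation_le_one_iff, ValuationSubring.valuation_le_one_iff, ← h,
    ValuationSubring.mem_comap]

theorem valuation_lt_iff_of_comap_eq {A : ValuationSubring K} {B : ValuationSubring L}
    {f : K →+* L} (h : B.comap f = A) (x y : K) :
    A.valuation x < A.valuation y ↔ B.valuation (f x) < B.valuation (f y) := by
  rw [← not_le, ← not_le, valuation_le_iff_of_comap_eq h]

section Approximation

variable {Γ : Type*} [LinearOrderedCommGroupWithZero Γ]

theorem exists_forall_approx {ι : Type*} (w : Valuation L Γ) (φ : ι → L) [Nonempty ι] (a : L)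
    (s : Finset L) :
    ∃ c, ∀ r ∈ s, (∃ c', w (φ c' - a) < w (r - a)) → w (φ c - a) < w (r - a) := by
  induction s using Finset.induction_on with
  | empty => exact ⟨Classical.arbitrary ι, by simp⟩
  | insert r s _ ih =>
    obtain ⟨c, hc⟩ := ih
    by_cases h : ∃ c', w (φ c' - a) < w (r - a)
    · obtain ⟨c', hc'⟩ := h
      rcases le_total (w (φ c - a)) (w (φ c' - a)) with hle | hle
      · refine ⟨c, fun t ht hex => ?_⟩
        rcases Finset.mem_insert.mp ht with rfl | ht
        · exact hle.trans_lt hc'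
        · exact hc t ht hex
      · refine ⟨c', fun t ht hex => ?_⟩
        rcases Finset.mem_insert.mp ht with rfl | ht
        · exact hc'
        · exact hle.trans_lt (hc t ht hex)
    · refine ⟨c, fun t ht hex => ?_⟩
      rcases Finset.mem_insert.mp ht with rfl | ht
      · exact absurd hex h
      · exact hc t ht hex

theorem valuation_prod_sub_prod_lt (w : Valuation L Γ) (b c : L) (s : Multiset L)
    (h : ∀ r ∈ s, w (c - b) < w (b - r)) :
    w ((s.map (c - ·)).prod - (s.map (b - ·)).prod) < w (s.map (b - ·)).prod := by
  induction s using Multiset.induction_on with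
  | empty => simp
  | cons r s ih =>
    have hs := ih fun t ht => h t (Multiset.mem_cons_of_mem ht)
    have hr := h r (Multiset.mem_cons_self r s)
    have heq := w.map_eq_of_sub_lt hs
    simp only [Multiset.map_cons, Multiset.prod_cons, map_mul]
    set x := (s.map (c - ·)).prod
    set y := (s.map (b - ·)).prod
    have hy : 0 < w y := zero_le.trans_lt hs
    have hbr : 0 < w (b - r) := zero_le.trans_lt hr
    rw [show (c - r) * x - (b - r) * y = (c - b) * x + (b - r) * (x - y) by ring]
    refine w.map_add_lt ?_ ?_
    · rw [map_mul, heq]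
      exact mul_lt_mul_of_pos_right hr hy
    · rw [map_mul]
      exact mul_lt_mul_of_pos_left hs hbr

variable [Algebra K L] [IsAlgClosed L]

theorem aeval_eq_mul_prod_aroots_sub (f : K[X]) (x : L) :
    aeval x f = algebraMap K L f.leadingCoeff * ((f.aroots L).map (x - ·)).prod :=
  Splits.aeval_eq_prod_aroots (IsAlgClosed.splits _) x

theorem valuation_aeval_le_aeval (w : Valuation L Γ) (f : K[X]) (x y : L)
    (h : ∀ r ∈ f.aroots L, w (x - r) ≤ w (y - r)) : w (aeval x f) ≤ w (aeval y f) := by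
  rw [aeval_eq_mul_prod_aroots_sub, aeval_eq_mul_prod_aroots_sub, map_mul, map_mul,
    map_multiset_prod, map_multiset_prod, Multiset.map_map, Multiset.map_map]
  exact mul_le_mul_right (Multiset.prod_map_le_prod_map₀ _ _ (fun _ _ => zero_le) h) _

theorem valuation_aeval_sub_aeval_lt (w : Valuation L Γ) {f : K[X]} (hf : f ≠ 0) (c b : L)
    (h : ∀ r ∈ f.aroots L, w (c - b) < w (b - r)) :
    w (aeval c f - aeval b f) < w (aeval b f) := by
  rw [aeval_eq_mul_prod_aroots_sub, aeval_eq_mul_prod_aroots_sub, ← mul_sub, map_mul, map_mul]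
  refine mul_lt_mul_of_pos_left (valuation_prod_sub_prod_lt w b c _ h) ?_
  rw [Valuation.pos_iff]
  simpa using hf

theorem valuation_aeval_lt_aeval (w : Valuation L Γ) {f : K[X]} (hf : f ≠ 0) (a x y : L)
    (ha : a ∈ f.aroots L) (hlt : w (x - a) < w (y - a))
    (h : ∀ r ∈ f.aroots L, w (x - r) ≤ w (y - r) ∧ 0 < w (y - r)) :
    w (aeval x f) < w (aeval y f) := by
  obtain ⟨s, hs⟩ := Multiset.exists_cons_of_mem ha
  rw [aeval_eq_mul_prod_aroots_sub, aeval_eq_mul_prod_aroots_sub, map_mul, map_mul,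
    map_multiset_prod, map_multiset_prod, Multiset.map_map, Multiset.map_map]
  rw [hs] at h ⊢
  have hlc : 0 < w (algebraMap K L f.leadingCoeff) := by
    rw [Valuation.pos_iff]
    simpa using hf
  refine mul_lt_mul_of_pos_left ?_ hlc
  simp only [Multiset.map_cons, Multiset.prod_cons, Function.comp_apply]
  refine mul_lt_mul_of_lt_of_le_of_nonneg_of_pos hlt ?_ zero_le ?_
  · exact Multiset.prod_map_le_prod_map₀ _ _ (fun _ _ => zero_le)
      fun r hr => (h r (Multiset.mem_cons_of_mem hr)).1
  · rw [pos_iff_ne_zero, Ne, Multiset.prod_eq_zero_iff]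
    intro h0
    obtain ⟨r, hr, hr0⟩ := Multiset.mem_map.mp h0
    exact (h r (Multiset.mem_cons_of_mem hr)).2.ne' hr0

end Approximation

/-- Over an algebraically maximal field, every algebraic element has a best approximation. -/
theorem IsAlgMaximal.exists_best_approx {K M : Type u} [Field K] [Field M] [Algebra K M]
    [IsAlgClosed M] [Algebra.IsAlgebraic K M] {A : ValuationSubring K} (hA : IsAlgMaximal A)
    {C : ValuationSubring M} (hC : C.comap (algebraMap K M) = A) (a : M) :
    ∃ c : K, ∀ d : K, C.valuation (algebraMap K M c - a) ≤ C.valuation (algebraMap K M d - a) := by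
  by_contra! hno
  set w := C.valuation
  let P : ℕ → Prop := fun n => ∃ q : K[X], q ≠ 0 ∧ q.natDegree = n ∧
    ∃ b : M, aeval b q = 0 ∧ ∀ c : K, w (b - a) < w (algebraMap K M c - a)
  have hP : ∃ n, P n := by
    refine ⟨_, minpoly K a, minpoly.ne_zero (Algebra.IsIntegral.isIntegral a), rfl, a,
      minpoly.aeval K a, fun c => ?_⟩
    obtain ⟨d, hd⟩ := hno c
    rw [sub_self, map_zero]
    exact zero_le.trans_lt hd
  obtain ⟨q, hq0, hqn, b, hqb, hba⟩ := Nat.find_spec hP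
  have hcb (c : K) : w (algebraMap K M c - b) = w (algebraMap K M c - a) := by
    refine w.map_eq_of_sub_lt ?_
    rw [sub_sub_sub_cancel_left, w.map_sub_swap]
    exact hba c
  have happrox : ∀ g : K[X], aeval b g ≠ 0 →
      ∃ e : K, w (algebraMap K M e - aeval b g) < w (aeval b g) := by
    intro g hg
    have hmod : aeval b g = aeval b (g % q) := by
      conv_lhs => rw [← EuclideanDomain.div_add_mod g q]
      simp [hqb]
    rw [hmod] at hg ⊢
    have hg0 : g % q ≠ 0 := by
      rintro h0
      simp [h0] at hg
    have hdeg : (g % q).natDegree < Nat.find hP := by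
      rw [← hqn]
      exact natDegree_lt_natDegree hg0 (EuclideanDomain.mod_lt g hq0)
    obtain ⟨c, hc⟩ := exists_forall_approx w (algebraMap K M) a ((g % q).aroots M).toFinset
    refine ⟨(g % q).eval c, ?_⟩
    rw [← aeval_algebraMap_apply_eq_algebraMap_eval]
    refine valuation_aeval_sub_aeval_lt w hg0 _ _ fun r hr => ?_
    have hex : ∃ c' : K, w (algebraMap K M c' - a) < w (r - a) := by
      by_contra! hle
      refine Nat.find_min hP hdeg ⟨g % q, hg0, rfl, r, (mem_aroots.mp hr).2, fun c' => ?_⟩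
      obtain ⟨d, hd⟩ := hno c'
      exact (hle d).trans_lt hd
    have hlt := hc r (Multiset.mem_toFinset.mpr hr) hex
    rw [hcb, ← sub_sub_sub_cancel_right b r a, w.map_sub_eq_of_lt_right ((hba c).trans hlt)]
    exact hlt
  have hB : (C.comap (algebraMap K⟮b⟯ M)).comap (algebraMap K K⟮b⟯) = A := by
    rw [← hC]
    rfl
  have himm (z : K⟮b⟯) (hz : z ≠ 0) : ∃ e : K,
      (C.comap (algebraMap K⟮b⟯ M)).valuation (algebraMap K K⟮b⟯ e - z) <
        (C.comap (algebraMap K⟮b⟯ M)).valuation z := by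
    have hmem : (z : M) ∈ K⟮b⟯.toSubalgebra := z.2
    rw [adjoin_simple_toSubalgebra_of_isAlgebraic (Algebra.IsAlgebraic.isAlgebraic b),
      Algebra.adjoin_singleton_eq_range_aeval] at hmem
    obtain ⟨g, hg⟩ := hmem
    change aeval b g = (z : M) at hg
    obtain ⟨e, he⟩ := happrox g (by rw [hg]; simpa using hz)
    refine ⟨e, (valuation_lt_iff_of_comap_eq (f := algebraMap K⟮b⟯ M) rfl _ _).mpr ?_⟩
    rw [hg] at he
    exact he
  obtain ⟨k, hk⟩ := hA K⟮b⟯ inferInstance _ hB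
    ⟨fun z hz => (himm z hz).imp fun e he => (Valuation.map_eq_of_sub_lt _ he).symm,
      fun z hz => by
        by_cases hz0 : z = 0
        · exact ⟨0, by simp [hz0]⟩
        · obtain ⟨e, he⟩ := himm z hz0
          exact ⟨e, by rw [Valuation.map_sub_swap]; exact he.trans_le hz⟩⟩
    (AdjoinSimple.gen K b)
  have hkb : algebraMap K M k = b := congrArg Subtype.val hk
  obtain ⟨d, hd⟩ := hno k
  rw [← hcb d, ← hcb k, hkb, sub_self, map_zero] at hd
  exact not_lt_zero hd

theorem IsAlgMaximal.oExtremal {K : Type u} [Field K] {A : ValuationSubring K}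
    (hA : IsAlgMaximal A) (f : K[X]) : OExtremal A f := by
  obtain ⟨C, hC⟩ := exists_valuationSubring_comap_eq (algebraMap K (AlgebraicClosure K)) A
  let ι := algebraMap K (AlgebraicClosure K)
  let w := C.valuation
  have hO (x : K) : x ∈ A ↔ w (ι x) ≤ 1 := by
    rw [ValuationSubring.valuation_le_one_iff, ← hC, ValuationSubring.mem_comap]
  unfold OExtremal
  simp only [valuation_le_iff_of_comap_eq hC, ← aeval_algebraMap_apply_eq_algebraMap_eval]
  by_contra! hno
  -- the elements of `A` for which `r` is a nearest root
  let S : AlgebraicClosure K → A → Prop := fun r c =>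
    ∀ t ∈ f.aroots (AlgebraicClosure K), w (ι c - r) ≤ w (ι c - t)
  have hfin : ∃ r ∈ f.aroots (AlgebraicClosure K),
      ∀ e : A, ∃ c : A, S r c ∧ w (aeval (ι c) f) < w (aeval (ι e) f) := by
    by_contra! hbd
    choose! e he using hbd
    obtain ⟨m, -, hm⟩ := Finset.exists_min_image
      (insert 0 ((f.aroots (AlgebraicClosure K)).toFinset.image e))
      (fun c : A => w (aeval (ι c) f)) (Finset.insert_nonempty _ _)
    obtain ⟨c, hc⟩ := hno m
    refine hc.not_ge ?_
    by_cases hne : (f.aroots (AlgebraicClosure K)).toFinset.Nonempty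
    · obtain ⟨r, hr, hrc⟩ := Finset.exists_min_image _ (fun r => w (ι c - r)) hne
      refine (hm (e r) (Finset.mem_insert_of_mem (Finset.mem_image_of_mem e hr))).trans
        (he r (Multiset.mem_toFinset.mp hr) c fun t ht => hrc t (Multiset.mem_toFinset.mpr ht))
    · refine valuation_aeval_le_aeval w f _ _ fun r hr => ?_
      exact absurd ⟨r, Multiset.mem_toFinset.mpr hr⟩ hne
  obtain ⟨a, -, ha⟩ := hfin
  obtain ⟨c, hc⟩ := hA.exists_best_approx hC a
  have hnear (x : K) (d : A) (hd : S a d) (hx : w (ι x - a) ≤ w (ι d - a)) :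
      w (aeval (ι x) f) ≤ w (aeval (ι d) f) := by
    refine valuation_aeval_le_aeval w f _ _ fun r hr => ?_
    rw [← sub_sub_sub_cancel_right (ι x) r a]
    refine w.map_sub_le (hx.trans (hd r hr)) ?_
    rw [← sub_sub_sub_cancel_left a r (ι d)]
    exact w.map_sub_le (hd r hr) le_rfl
  by_cases hcA : c ∈ A
  · obtain ⟨d, hd, hlt⟩ := ha ⟨c, hcA⟩
    exact hlt.not_ge (hnear c d hd (hc d))
  · obtain ⟨d, hd, -⟩ := ha 0
    obtain ⟨d', hd', hlt⟩ := ha d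
    refine hlt.not_ge (hnear d d' hd' ?_)
    by_contra! hgt
    have hdd' : w (ι d - ι d') ≤ 1 := w.map_sub_le ((hO d).mp d.2) ((hO d').mp d'.2)
    have hle : w (ι d - a) ≤ 1 := by
      by_contra! h1
      refine (w.map_sub_lt (hdd'.trans_lt h1) ((w.map_sub_swap _ _).trans_lt hgt)
        : w ((ι d - ι d') - (a - ι d')) < w (ι d - a)).ne ?_
      rw [sub_sub_sub_cancel_right]
    refine hcA ((hO c).mpr ?_)
    have hda : w (ι c - ι d) ≤ 1 := by
      rw [← sub_sub_sub_cancel_right (ι c) (ι d) a]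
      exact w.map_sub_le ((hc d).trans hle) hle
    simpa using w.map_add_le hda ((hO d).mp d.2)

theorem IsImmediate.exists_better_approx {K : Type u} {L : Type v} [Field K] [Field L]
    [Algebra K L] {B : ValuationSubring L} (hB : IsImmediate K B) {x : L}
    (hx : ∀ c, algebraMap K L c ≠ x) (c : K) :
    ∃ d : K, B.valuation (algebraMap K L d - x) < B.valuation (algebraMap K L c - x) := by
  have hxc : x - algebraMap K L c ≠ 0 := sub_ne_zero.mpr (hx c).symm
  have hpos : 0 < B.valuation (x - algebraMap K L c) := (Valuation.pos_iff _).mpr hxc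
  obtain ⟨γ, hγ⟩ := hB.1 _ hxc
  have hγ0 : algebraMap K L γ ≠ 0 := by
    rw [← Valuation.pos_iff B.valuation, ← hγ]
    exact hpos
  obtain ⟨e, he⟩ := hB.2 ((x - algebraMap K L c) / algebraMap K L γ) (by
    rw [map_div₀, ← hγ, div_self hpos.ne'])
  refine ⟨c + γ * e, ?_⟩
  rw [Valuation.map_sub_swap, Valuation.map_sub_swap _ (algebraMap K L c)]
  have heq : x - algebraMap K L (c + γ * e) = algebraMap K L γ *
      ((x - algebraMap K L c) / algebraMap K L γ - algebraMap K L e) := by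
    rw [mul_sub, mul_div_cancel₀ _ hγ0, map_add, map_mul]
    ring
  rw [heq, map_mul, hγ]
  exact mul_lt_of_lt_one_right (hγ ▸ hpos) he

theorem isAlgMaximal_of_oExtremal {K : Type u} [Field K] {A : ValuationSubring K}
    (hA : ∀ f : K[X], OExtremal A f) : IsAlgMaximal A := by
  intro L _ _ _ B hBA hB
  by_contra hsurj
  obtain ⟨x, hx⟩ : ∃ x : L, ∀ c, algebraMap K L c ≠ x := by
    simpa [Function.Surjective] using hsurj
  obtain ⟨C, hC⟩ := exists_valuationSubring_comap_eq (algebraMap L (AlgebraicClosure L)) B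
  let ι := algebraMap K (AlgebraicClosure L)
  let a := algebraMap L (AlgebraicClosure L) x
  let w := C.valuation
  have hCA : C.comap ι = A := by
    rw [← hBA, ← hC]
    ext z
    simp [ι, ValuationSubring.mem_comap, ← IsScalarTower.algebraMap_apply]
  have hι (c : K) : ι c - a = algebraMap L (AlgebraicClosure L) (algebraMap K L c - x) := by
    rw [map_sub, ← IsScalarTower.algebraMap_apply]
  have hno (c : K) : ∃ d : K, w (ι d - a) < w (ι c - a) := by
    obtain ⟨d, hd⟩ := hB.exists_better_approx hx c
    refine ⟨d, ?_⟩
    rw [hι, hι]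
    exact (valuation_lt_iff_of_comap_eq hC _ _).mp hd
  let f := minpoly K x
  have hf : f ≠ 0 := minpoly.ne_zero (Algebra.IsIntegral.isIntegral x)
  have haf : a ∈ f.aroots (AlgebraicClosure L) :=
    mem_aroots.mpr ⟨hf, by simp [f, a, aeval_algebraMap_apply]⟩
  obtain ⟨c₀, hc₀⟩ := exists_forall_approx w ι a (f.aroots (AlgebraicClosure L)).toFinset
  obtain ⟨γ, hγB⟩ := hB.1 _ (sub_ne_zero.mpr (hx c₀))
  have hγ : w (ι c₀ - a) = w (ι γ) := by
    rw [hι, show ι γ = algebraMap L (AlgebraicClosure L) (algebraMap K L γ) from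
      IsScalarTower.algebraMap_apply _ _ _ _]
    exact le_antisymm ((valuation_le_iff_of_comap_eq hC _ _).mp hγB.le)
      ((valuation_le_iff_of_comap_eq hC _ _).mp hγB.ge)
  have hγpos : 0 < w (ι γ) := by
    obtain ⟨d, hd⟩ := hno c₀
    rw [← hγ]
    exact zero_le.trans_lt hd
  have hO (y : K) : y ∈ A ↔ w (ι y) ≤ 1 := by
    rw [ValuationSubring.valuation_le_one_iff, ← hCA, ValuationSubring.mem_comap]
  obtain ⟨m, hm⟩ := hA (f.comp (Polynomial.C c₀ + Polynomial.C γ * X))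
  let c := c₀ + γ * (m : K)
  have hca : w (ι c - a) ≤ w (ι γ) := by
    have : ι c - a = (ι c₀ - a) + ι γ * ι m := by
      simp only [c, map_add, map_mul]
      ring
    rw [this]
    refine w.map_add_le hγ.le ?_
    rw [map_mul]
    exact mul_le_of_le_one_right' ((hO m).mp m.2)
  obtain ⟨d, hd⟩ := hno c
  have hdA : (d - c₀) / γ ∈ A := by
    rw [hO, map_div₀, map_div₀, div_le_one₀ hγpos, map_sub,
      ← sub_sub_sub_cancel_right (ι d) (ι c₀) a]
    exact w.map_sub_le (hd.le.trans hca) hγ.le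
  have hγ0 : γ ≠ 0 := by
    rintro rfl
    simp at hγpos
  have hle := hm ⟨_, hdA⟩
  simp only [eval_comp, eval_add, eval_C, eval_mul, eval_X, mul_div_cancel₀ _ hγ0,
    add_sub_cancel] at hle
  rw [valuation_le_iff_of_comap_eq hCA, ← aeval_algebraMap_apply_eq_algebraMap_eval,
    ← aeval_algebraMap_apply_eq_algebraMap_eval] at hle
  refine hle.not_gt (valuation_aeval_lt_aeval w hf a _ _ haf hd fun r hr => ?_)
  change w (ι d - r) ≤ w (ι c - r) ∧ 0 < w (ι c - r)
  rw [← sub_sub_sub_cancel_right (ι d) r a, ← sub_sub_sub_cancel_right (ι c) r a]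
  by_cases hex : ∃ c', w (ι c' - a) < w (r - a)
  · have hcr : w (ι c - a) < w (r - a) :=
      (hca.trans hγ.ge).trans_lt (hc₀ r (Multiset.mem_toFinset.mpr hr) hex)
    rw [w.map_sub_eq_of_lt_right hcr, w.map_sub_eq_of_lt_right (hd.trans hcr)]
    exact ⟨le_rfl, zero_le.trans_lt hcr⟩
  · push Not at hex
    have hrd := hex d
    rw [w.map_sub_eq_of_lt_left (hrd.trans_lt hd)]
    exact ⟨w.map_sub_le hd.le (hrd.trans hd.le), zero_le.trans_lt hd⟩

/-- A valued field is algebraically maximal if and only if it is `O`-extremal with respect to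
every polynomial in one variable with coefficients in `K`. -/
theorem statement2 {K : Type u} [Field K] (A : ValuationSubring K) :
    IsAlgMaximal A ↔ ∀ f : Polynomial K, OExtremal A f := by
  exact ⟨fun hA => hA.oExtremal, isAlgMaximal_of_oExtremal⟩

end ValuedDefect
end
end
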